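/- arXiv:math/0212347 — 2 statements merged into one kernel-verified Lean document; each statement's English description precedes it below -/
import Mathlib

section
/- Let f be a symmetric polynomial in n variables over ℂ that vanishes whenever k+1 of its variables are equal. If λ = (1^{m_1},...,k^{m_k}) is a partition of n with all parts at most k, and φ_λ is the evaluation map sending the variables, grouped into blocks according to λ, to variables x_i^{(a)} (for 1 ≤ a ≤ k, 1 ≤ i ≤ m_a, each variable x_i^{(a)} substituted with multiplicity a), then φ_λ(f) is divisible by ∏_{a<b} ∏_{i,j} (x_i^{(a)} - x_j^{(b)})^{2a} · ∏_a ∏_{i<j} (x_i^{(a)} - x_j^{(a)})^{2a} provided f additionally vanishes under every evaluation φ_ν for partitions ν ≻ λ in lexicographic order. -/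
open MvPolynomial

/-- The list of parts (in decreasing order) of the partition whose part `a+1` occurs
with multiplicity `m a`, for `a : Fin k`. -/
def partsOf {k : ℕ} (m : Fin k → ℕ) : List ℕ :=
  (((List.finRange k).reverse).map fun a => List.replicate (m a) ((a : ℕ) + 1)).flatten

/-- `b` groups the `n` variables into blocks: for each index `p = (a, i)` (the `i`-th block
of size `a+1`), exactly `a+1` of the variables are sent to `p`. -/
def IsBlockMap {k n : ℕ} (m : Fin k → ℕ) (b : Fin n → (a : Fin k) × Fin (m a)) : Prop :=
  ∀ p : (a : Fin k) × Fin (m a),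
    (Finset.univ.filter fun i => b i = p).card = (p.1 : ℕ) + 1

/-- A linear order on the block indices, used to enumerate each unordered pair once. -/
def pairLT {k : ℕ} {m : Fin k → ℕ} (p q : (a : Fin k) × Fin (m a)) : Prop :=
  (p.1 : ℕ) < (q.1 : ℕ) ∨ ((p.1 : ℕ) = (q.1 : ℕ) ∧ (p.2 : ℕ) < (q.2 : ℕ))

instance {k : ℕ} {m : Fin k → ℕ} (p q : (a : Fin k) × Fin (m a)) : Decidable (pairLT p q) := by
  unfold pairLT; infer_instance

namespace MvPolynomial

variable {R σ τ : Type*} [CommRing R]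

theorem X_sub_X_dvd_sub_rename_update [DecidableEq τ] (u v : τ) (g : MvPolynomial τ R) :
    X u - X v ∣ g - rename (Function.update id u v) g := by
  rw [← Ideal.mem_span_singleton, ← Ideal.Quotient.eq]
  set I : Ideal (MvPolynomial τ R) := Ideal.span {X u - X v} with hI
  have h : Ideal.Quotient.mkₐ R I = (Ideal.Quotient.mkₐ R I).comp
      (rename (Function.update id u v)) := by
    refine algHom_ext fun t => ?_
    rcases eq_or_ne t u with rfl | ht
    · simp [Ideal.Quotient.eq, hI]
    · simp [ht]
  exact DFunLike.congr_fun h g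

theorem X_sub_X_dvd_iff [DecidableEq τ] {u v : τ} {g : MvPolynomial τ R} :
    X u - X v ∣ g ↔ rename (Function.update id u v) g = 0 := by
  constructor
  · rintro ⟨h, rfl⟩
    rcases eq_or_ne v u with rfl | hv
    · simp
    · simp [hv]
  · intro h
    simpa [h] using X_sub_X_dvd_sub_rename_update u v g

theorem prime_X_sub_X [IsDomain R] {u v : τ} (huv : u ≠ v) :
    Prime (X u - X v : MvPolynomial τ R) := by
  classical
  refine ⟨sub_ne_zero.2 fun h => huv (X_injective h), fun h => ?_, fun a b => ?_⟩
  · have := X_sub_X_dvd_iff.1 (isUnit_iff_dvd_one.1 h)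
    simp at this
  · simp only [X_sub_X_dvd_iff, map_mul, mul_eq_zero, imp_self]

theorem isRelPrime_X_sub_X [IsDomain R] {u v u' v' : τ} (huv : u ≠ v) (huv' : u' ≠ v')
    (h : ¬(u' = u ∧ v' = v)) (h' : ¬(u' = v ∧ v' = u)) :
    IsRelPrime (X u - X v : MvPolynomial τ R) (X u' - X v') := by
  classical
  rw [(prime_X_sub_X huv).irreducible.isRelPrime_iff_not_dvd, X_sub_X_dvd_iff, map_sub, rename_X,
    rename_X, sub_eq_zero, (X_injective (R := R)).eq_iff]
  simp only [Function.update_apply, id]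
  grind

theorem X_sub_X_sq_dvd [IsDomain R] {u v : τ} (huv : u ≠ v) {g : MvPolynomial τ R}
    [DecidableEq τ] (h : rename (Function.update id u v) g = 0)
    (h' : rename (Function.update id u v) (pderiv u g) = 0) : (X u - X v) ^ 2 ∣ g := by
  obtain ⟨g₁, rfl⟩ := X_sub_X_dvd_iff.2 h
  have hX : pderiv u (X u - X v : MvPolynomial τ R) = 1 := by
    simp [pderiv_X_of_ne huv.symm]
  rw [pow_two]
  refine mul_dvd_mul_left _ (X_sub_X_dvd_iff.2 ?_)
  simpa [Derivation.leibniz, hX, huv.symm, pderiv_X_of_ne huv.symm] using h'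

theorem pderiv_rename_eq_sum [Fintype σ] [DecidableEq τ] (κ : σ → τ) (t : τ)
    (f : MvPolynomial σ R) :
    pderiv t (rename κ f) = ∑ j with κ j = t, rename κ (pderiv j f) := by
  classical
  induction f using MvPolynomial.induction_on with
  | C a => simp
  | add p q hp hq => simp [hp, hq, Finset.sum_add_distrib]
  | mul_X p i hp =>
    simp only [map_mul, Derivation.leibniz, map_add, smul_eq_mul, hp, rename_X, pderiv_X,
      Finset.sum_add_distrib, Finset.mul_sum]
    congr 1
    rw [← Finset.mul_sum, Finset.sum_filter]
    congr 1
    rw [Finset.sum_eq_single i]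
    · simp [Pi.single_apply, eq_comm]
    · intro j _ hj
      simp [hj.symm]
    · simp

theorem IsSymmetric.rename_pderiv_eq_zero [Fintype σ] [IsDomain R] [CharZero R]
    {f : MvPolynomial σ R} (hf : f.IsSymmetric) {κ : σ → τ} (h : rename κ f = 0) (i : σ) :
    rename κ (pderiv i f) = 0 := by
  classical
  have key : ∀ j ∈ Finset.univ.filter (fun j => κ j = κ i),
      rename κ (pderiv j f) = rename κ (pderiv i f) := by
    intro j hj
    have hj : κ j = κ i := by simpa using hj
    have h1 : pderiv j f = rename (Equiv.swap i j) (pderiv i f) := by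
      rw [← pderiv_rename (Equiv.swap i j).injective, hf, Equiv.swap_apply_left]
    rw [h1, rename_rename]
    congr 2
    ext l
    simp only [Function.comp, Equiv.swap_apply_def]
    grind
  have h2 := pderiv_rename_eq_sum κ (κ i) f
  rw [h, map_zero, Finset.sum_congr rfl key, Finset.sum_const, eq_comm, smul_eq_zero] at h2
  refine h2.resolve_left fun h0 => ?_
  have : i ∈ Finset.univ.filter (fun j => κ j = κ i) := by simp
  simp [Finset.card_eq_zero.1 h0] at this

theorem IsSymmetric.X_sub_X_sq_dvd_rename [Fintype σ] [IsDomain R] [CharZero R] [DecidableEq σ]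
    {f : MvPolynomial σ R} (hf : f.IsSymmetric) {κ : σ → τ} {i : σ} {v : τ}
    (hi : ∀ j, κ j = κ i → j = i) (hv : κ i ≠ v) (h : rename (Function.update κ i v) f = 0) :
    (X (κ i) - X v) ^ 2 ∣ rename κ f := by
  classical
  have hc : Function.update id (κ i) v ∘ κ = Function.update κ i v := by
    ext j
    simp only [Function.comp, Function.update_apply, id]
    grind
  have hs : (Finset.univ.filter fun j => κ j = κ i) = {i} := by
    ext j
    simpa using ⟨hi j, fun h => h ▸ rfl⟩
  refine X_sub_X_sq_dvd hv ?_ ?_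
  · rwa [rename_rename, hc]
  · rw [pderiv_rename_eq_sum, hs, Finset.sum_singleton, rename_rename, hc]
    exact hf.rename_pderiv_eq_zero h i

/-- If `f` vanishes whenever one more variable joins those equal to `v`, then letting all variables
of the fibre over `u` coincide contributes a zero of twice the size of that fibre. -/
theorem IsSymmetric.X_sub_X_pow_dvd_rename [Fintype σ] [IsDomain R] [CharZero R] [DecidableEq τ]
    [UniqueFactorizationMonoid R] [DecidableEq σ]
    {f : MvPolynomial σ R} (hf : f.IsSymmetric) {b : σ → τ} {u v : τ}
    (h : ∀ i, b i = u → rename (Function.update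
      (fun j => if b j = u then Sum.inr j else Sum.inl (b j)) i (Sum.inl v) : σ → τ ⊕ σ) f = 0) :
    (X u - X v) ^ (2 * (Finset.univ.filter fun i => b i = u).card) ∣ rename b f := by
  set κ : σ → τ ⊕ σ := fun j => if b j = u then Sum.inr j else Sum.inl (b j) with hκ
  have hprod : (∏ i with b i = u, (X (κ i) - X (Sum.inl v)) ^ 2 : MvPolynomial (τ ⊕ σ) R) ∣
      rename κ f := by
    refine Finset.prod_dvd_of_isRelPrime ?_ ?_
    · intro i hi j hj hij
      simp only [Finset.coe_filter, Finset.mem_univ, true_and, Set.mem_ofPred_eq] at hi hj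
      refine IsRelPrime.pow (isRelPrime_X_sub_X ?_ ?_ ?_ ?_) <;> simp [hκ, hi, hj, hij.symm]
    · intro i hi
      have hi : b i = u := by simpa using hi
      refine hf.X_sub_X_sq_dvd_rename (fun j => ?_) ?_ (h i hi)
      · simp only [hκ, hi]
        grind
      · simp [hκ, hi]
  have hmap := map_dvd (rename (Sum.elim id fun _ => u)) hprod
  have hb : (Sum.elim id fun _ => u) ∘ κ = b := by
    ext j
    by_cases hj : b j = u <;> simp [hκ, hj]
  rw [rename_rename, hb, map_prod, Finset.prod_congr rfl (g := fun _ => (X u - X v) ^ 2),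
    Finset.prod_const, ← pow_mul] at hmap
  · exact hmap
  · intro i hi
    have hi : b i = u := by simpa using hi
    simp [hκ, hi]

end MvPolynomial

theorem List.lex_append_replicate {l r r' : List ℕ} {x s t : ℕ} (hst : s < t)
    (hr : ∀ y ∈ r, y < x) :
    List.Lex (· < ·) (l ++ (List.replicate s x ++ r)) (l ++ (List.replicate t x ++ r')) := by
  obtain ⟨d, rfl⟩ := Nat.exists_eq_add_of_lt hst
  rw [Nat.add_assoc, List.replicate_add, List.append_assoc, List.replicate_succ]
  refine List.Lex.append_left _ (List.Lex.append_left _ ?_ _) _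
  cases r with
  | nil => exact .nil
  | cons y r => exact .rel (hr y (by simp))

theorem lex_partsOf {k : ℕ} {m m' : Fin k → ℕ} {a : Fin k} (ha : m a < m' a)
    (h : ∀ c, a < c → m' c = m c) : List.Lex (· < ·) (partsOf m) (partsOf m') := by
  obtain ⟨s, t, hst⟩ := List.append_of_mem (List.mem_reverse.2 (List.mem_finRange a))
  have hp : (s ++ a :: t).Pairwise (· > ·) := by
    rw [← hst, List.pairwise_reverse]
    exact List.pairwise_lt_finRange k
  rw [List.pairwise_append, List.pairwise_cons] at hp
  have hs : s.map (fun c => List.replicate (m' c) ((c : ℕ) + 1)) =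
      s.map (fun c => List.replicate (m c) ((c : ℕ) + 1)) :=
    List.map_congr_left fun c hc => by rw [h c (hp.2.2 c hc a (by simp))]
  simp only [partsOf, hst, List.map_append, List.map_cons, List.flatten_append, List.flatten_cons,
    hs]
  refine List.lex_append_replicate ha fun y hy => ?_
  simp only [List.mem_flatten, List.mem_map] at hy
  obtain ⟨_, ⟨c, hc, rfl⟩, hy⟩ := hy
  rw [List.eq_of_mem_replicate hy]
  have := hp.2.1.1 c hc
  omega

theorem IsBlockMap.sum_eq {k n : ℕ} {m : Fin k → ℕ} {b : Fin n → (a : Fin k) × Fin (m a)}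
    (hb : IsBlockMap m b) : ∑ a : Fin k, ((a : ℕ) + 1) * m a = n := by
  have h := Finset.card_eq_sum_card_fiberwise (f := b) (s := Finset.univ) (t := Finset.univ)
    (by simp)
  simp only [Finset.card_univ, Fintype.card_fin] at h
  rw [h, Finset.sum_congr rfl fun p _ => hb p, Fintype.sum_sigma]
  simp [mul_comm]

/-- Any map with fibres of size at most `k` factors through a block map. -/
theorem exists_isBlockMap {k n : ℕ} {τ : Type*} [Fintype τ] [DecidableEq τ] (κ : Fin n → τ)
    (hκ : ∀ t, (Finset.univ.filter fun i => κ i = t).card ≤ k) {m : Fin k → ℕ}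
    (hm : ∀ a : Fin k, (Finset.univ.filter fun t =>
      (Finset.univ.filter fun i => κ i = t).card = (a : ℕ) + 1).card = m a) :
    ∃ (b : Fin n → (a : Fin k) × Fin (m a)) (g : (a : Fin k) × Fin (m a) → τ),
      IsBlockMap m b ∧ g ∘ b = κ := by
  classical
  let F : τ → ℕ := fun t => (Finset.univ.filter fun i => κ i = t).card
  have e : ∀ a : Fin k, Nonempty ({t // F t = (a : ℕ) + 1} ≃ Fin (m a)) := fun a =>
    Fintype.card_eq.1 (by rw [Fintype.card_subtype, hm, Fintype.card_fin])
  have e := fun a => (e a).some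
  have hpos : ∀ i, 0 < F (κ i) := fun i => Finset.card_pos.2 ⟨i, by simp⟩
  have hlt : ∀ i, F (κ i) - 1 < k := fun i => by
    have := hpos i
    have : F (κ i) ≤ k := hκ (κ i)
    omega
  have hsub : ∀ i, F (κ i) = F (κ i) - 1 + 1 := fun i => by
    have := hpos i
    omega
  let b : Fin n → (a : Fin k) × Fin (m a) := fun i => ⟨⟨F (κ i) - 1, hlt i⟩, e _ ⟨κ i, hsub i⟩⟩
  let g : (a : Fin k) × Fin (m a) → τ := fun p => ((e p.1).symm p.2).1
  have hgb : ∀ i, g (b i) = κ i := fun i => by simp [g, b]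
  have hFg : ∀ p, F (g p) = (p.1 : ℕ) + 1 := fun p => ((e p.1).symm p.2).2
  have hg : Function.Injective g := by
    intro p q hpq
    have h1 : p.1 = q.1 := Fin.ext (by have := hFg p; rw [hpq, hFg q] at this; omega)
    obtain ⟨a, x⟩ := p
    obtain ⟨a', y⟩ := q
    obtain rfl : a = a' := h1
    exact congrArg (Sigma.mk a) ((e a).symm.injective (Subtype.ext hpq))
  refine ⟨b, g, fun p => ?_, funext hgb⟩
  rw [← hFg p]
  refine congrArg _ (Finset.filter_congr fun i _ => ?_)
  rw [← hgb i, hg.eq_iff]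

theorem MvPolynomial.IsSymmetric.rename_eq_zero_of_card_fiber {R τ : Type*} [CommRing R]
    [DecidableEq τ] {k n : ℕ} {f : MvPolynomial (Fin n) R} (hf : f.IsSymmetric)
    (h : rename (fun i : Fin n => if (i : ℕ) < k then (Sum.inl () : Unit ⊕ Fin n) else Sum.inr i)
      f = 0) {κ : Fin n → τ} {t : τ} (ht : (Finset.univ.filter fun i => κ i = t).card = k) :
    rename κ f = 0 := by
  have hkn : k ≤ n := by
    rw [← ht]
    exact (Finset.card_le_univ _).trans_eq (Fintype.card_fin n)
  have hcard : Fintype.card {i : Fin n // (i : ℕ) < k} = Fintype.card {i : Fin n // κ i = t} := by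
    rw [Fintype.card_subtype, Fintype.card_subtype, ht, Fin.card_filter_val_lt, min_eq_right hkn]
  let e₀ := Fintype.equivOfCardEq hcard
  let e : Equiv.Perm (Fin n) := e₀.extendSubtype
  have hκ : κ = (Sum.elim (fun _ => t) (κ ∘ e)) ∘
      (fun i : Fin n => if (i : ℕ) < k then (Sum.inl () : Unit ⊕ Fin n) else Sum.inr i) ∘ e.symm := by
    ext j
    obtain ⟨i, rfl⟩ := e.surjective j
    by_cases hi : (i : ℕ) < k
    · simpa [hi] using e₀.extendSubtype_mem i hi
    · simp [hi]
  rw [hκ, ← rename_rename, ← rename_rename, hf, h, map_zero]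

theorem rename_update_eq_zero {k n : ℕ} {f : MvPolynomial (Fin n) ℂ} (hsym : f.IsSymmetric)
    (hvan : k + 1 ≤ n → rename (fun i : Fin n => if (i : ℕ) < k + 1 then
      (Sum.inl () : Unit ⊕ Fin n) else Sum.inr i) f = 0)
    {m : Fin k → ℕ} {b : Fin n → (a : Fin k) × Fin (m a)} (hb : IsBlockMap m b)
    (hlex : ∀ m' : Fin k → ℕ, (∑ a : Fin k, ((a : ℕ) + 1) * m' a = n) →
      List.Lex (· < ·) (partsOf m) (partsOf m') →
      ∀ b' : Fin n → (a : Fin k) × Fin (m' a), IsBlockMap m' b' → rename b' f = 0)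
    {p q : (a : Fin k) × Fin (m a)} (hpq : q ≠ p) (hle : q.1 ≤ p.1) {i : Fin n} (hi : b i = q) :
    rename (Function.update (fun j => if b j = q then Sum.inr j else Sum.inl (b j)) i (Sum.inl p) :
      Fin n → ((a : Fin k) × Fin (m a)) ⊕ Fin n) f = 0 := by
  set κ : Fin n → ((a : Fin k) × Fin (m a)) ⊕ Fin n :=
    Function.update (fun j => if b j = q then Sum.inr j else Sum.inl (b j)) i (Sum.inl p) with hκ
  have hκi : ∀ j, κ j = if j = i then Sum.inl p else
      if b j = q then Sum.inr j else Sum.inl (b j) := fun j => by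
    rw [hκ, Function.update_apply]
  have hFp : (Finset.univ.filter fun j => κ j = Sum.inl p).card = p.1 + 2 := by
    have : (Finset.univ.filter fun j => κ j = Sum.inl p) =
        insert i (Finset.univ.filter fun j => b j = p) := by
      ext j
      simp only [Finset.mem_filter, Finset.mem_univ, true_and, Finset.mem_insert, hκi]
      grind
    rw [this, Finset.card_insert_of_notMem (by simpa [hi] using hpq), hb p]
  have hFq : (Finset.univ.filter fun j => κ j = Sum.inl q).card = 0 := by
    rw [Finset.card_eq_zero, Finset.filter_eq_empty_iff]
    intro j _
    rw [hκi]
    grind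
  have hFr : ∀ r, r ≠ p → r ≠ q →
      (Finset.univ.filter fun j => κ j = Sum.inl r).card = r.1 + 1 := by
    intro r hrp hrq
    rw [← hb r]
    refine congrArg _ (Finset.filter_congr fun j _ => ?_)
    rw [hκi]
    grind
  have hFj : ∀ j, (Finset.univ.filter fun l => κ l = Sum.inr j).card ≤ 1 := by
    intro j
    refine Finset.card_le_one.2 fun l hl l' hl' => ?_
    simp only [Finset.mem_filter, Finset.mem_univ, true_and, hκi] at hl hl'
    grind
  rcases Nat.lt_or_ge (p.1 + 1) k with hk | hk
  · have hF : ∀ t, (Finset.univ.filter fun j => κ j = t).card ≤ k := by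
      rintro (r | j)
      · rcases eq_or_ne r p with rfl | hrp
        · omega
        rcases eq_or_ne r q with rfl | hrq
        · omega
        rw [hFr r hrp hrq]
        omega
      · have := hFj j
        omega
    obtain ⟨b', g, hb', hg⟩ := exists_isBlockMap κ hF fun _ => rfl
    rw [← hg, ← rename_rename, hlex _ hb'.sum_eq _ b' hb', map_zero]
    have hm : ∀ c, m c = (Finset.univ.filter fun r : (a : Fin k) × Fin (m a) => r.1 = c).card := by
      intro c
      rw [← Fintype.card_subtype, Fintype.card_congr (Equiv.sigmaSubtype c), Fintype.card_fin]
    have hinl : Function.Injective (Sum.inl : _ → ((a : Fin k) × Fin (m a)) ⊕ Fin n) :=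
      Sum.inl_injective
    refine lex_partsOf (a := ⟨p.1 + 1, hk⟩) ?_ fun c hc => ?_
    · rw [hm, ← Finset.card_image_of_injective _ hinl, Nat.lt_iff_add_one_le,
        ← Finset.card_insert_of_notMem (a := Sum.inl p)]
      · refine Finset.card_le_card fun t ht => ?_
        simp only [Finset.mem_insert, Finset.mem_image, Finset.mem_filter, Finset.mem_univ,
          true_and] at ht ⊢
        rcases ht with rfl | ⟨r, hr, rfl⟩
        · exact hFp
        · have hr' : (r.1 : ℕ) = p.1 + 1 := congrArg Fin.val hr
          have hle' : (q.1 : ℕ) ≤ p.1 := hle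
          rw [hFr r (by rintro rfl; omega) (by rintro rfl; omega), hr']
      · simp [Fin.ext_iff]
    · have hc' : (p.1 : ℕ) + 1 < c := hc
      have hle' : (q.1 : ℕ) ≤ p.1 := hle
      rw [hm c, ← Finset.card_image_of_injective _ hinl]
      congr 1
      ext t
      simp only [Finset.mem_image, Finset.mem_filter, Finset.mem_univ, true_and]
      rcases t with r | j
      · simp only [Sum.inl.injEq, exists_eq_right, Fin.ext_iff]
        rcases eq_or_ne r p with rfl | hrp
        · omega
        rcases eq_or_ne r q with rfl | hrq
        · omega
        rw [hFr r hrp hrq]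
        omega
      · have := hFj j
        simp only [reduceCtorEq, and_false, exists_false, iff_false]
        omega
  · have hpk := p.1.isLt
    have hF : (Finset.univ.filter fun j => κ j = Sum.inl p).card = k + 1 := by omega
    refine hsym.rename_eq_zero_of_card_fiber (hvan ?_) hF
    rw [← hF]
    exact (Finset.card_le_univ _).trans_eq (Fintype.card_fin n)

/-- Let `f` be a symmetric polynomial in `n` variables over `ℂ` which
vanishes whenever `k+1` of its variables are equal.  Let `λ` be a partition of `n` with all
parts at most `k` (encoded by its multiplicities `m : Fin k → ℕ`, where the part `a+1`
occurs `m a` times) and let `φ_λ` be the block-evaluation map determined by a block map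
`b`.  If moreover `f` vanishes under every block evaluation `φ_ν` for partitions
`ν ≻ λ` in lexicographic order, then `φ_λ(f)` is divisible by
`∏_{a<b} ∏_{i,j} (x_i^{(a)} - x_j^{(b)})^{2a} · ∏_a ∏_{i<j} (x_i^{(a)} - x_j^{(a)})^{2a}`
(each unordered pair of distinct block indices contributing exponent twice the smaller
part). -/
theorem gordon_divisibility_k2 (k n : ℕ) (f : MvPolynomial (Fin n) ℂ) (hsym : f.IsSymmetric)
    (hvan : k + 1 ≤ n →
      aeval (fun i : Fin n => if (i : ℕ) < k + 1 then
          (X (Sum.inl ()) : MvPolynomial (Unit ⊕ Fin n) ℂ) else X (Sum.inr i)) f = 0)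
    (m : Fin k → ℕ) (hm : ∑ a : Fin k, ((a : ℕ) + 1) * m a = n)
    (b : Fin n → (a : Fin k) × Fin (m a)) (hb : IsBlockMap m b)
    (hlex : ∀ m' : Fin k → ℕ, (∑ a : Fin k, ((a : ℕ) + 1) * m' a = n) →
      List.Lex (· < ·) (partsOf m) (partsOf m') →
      ∀ b' : Fin n → (a : Fin k) × Fin (m' a), IsBlockMap m' b' →
        aeval (fun i => X (b' i)) f = (0 : MvPolynomial ((a : Fin k) × Fin (m' a)) ℂ)) :
    ((∏ pq ∈ Finset.univ.filter
        (fun pq : ((a : Fin k) × Fin (m a)) × ((a : Fin k) × Fin (m a)) =>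
          pairLT pq.1 pq.2),
        (X pq.1 - X pq.2) ^ (2 * (min (pq.1.1 : ℕ) (pq.2.1 : ℕ) + 1))) : MvPolynomial ((a : Fin k) × Fin (m a)) ℂ)
      ∣ aeval (fun i => X (b i)) f := by
  have hX : ∀ {τ : Type} (κ : Fin n → τ),
      aeval (fun i => (X (κ i) : MvPolynomial τ ℂ)) f = rename κ f := fun {τ} κ => by
    have h : aeval (fun i => (X (κ i) : MvPolynomial τ ℂ)) = rename κ := algHom_ext (by simp)
    rw [h]
  simp only [hX, ← apply_ite (X : Unit ⊕ Fin n → MvPolynomial (Unit ⊕ Fin n) ℂ)] at hvan hlex ⊢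
  refine Finset.prod_dvd_of_isRelPrime ?_ ?_
  · rintro ⟨p, q⟩ hpq ⟨p', q'⟩ hpq' hne
    replace hpq : pairLT p q := (Finset.mem_filter.1 hpq).2
    replace hpq' : pairLT p' q' := (Finset.mem_filter.1 hpq').2
    unfold pairLT at hpq hpq'
    refine IsRelPrime.pow (isRelPrime_X_sub_X ?_ ?_ ?_ ?_)
    · rintro (rfl : p = q)
      omega
    · rintro (rfl : p' = q')
      omega
    · rintro ⟨rfl, rfl⟩
      exact hne rfl
    · rintro ⟨rfl : p' = q, rfl : q' = p⟩
      omega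
  · rintro ⟨q, p⟩ hqp
    replace hqp : pairLT q p := (Finset.mem_filter.1 hqp).2
    unfold pairLT at hqp
    have hle : (q.1 : ℕ) ≤ p.1 := by omega
    have hne : q ≠ p := by
      rintro rfl
      omega
    have h := hsym.X_sub_X_pow_dvd_rename (b := b) (u := q) (v := p) fun i hi =>
      rename_update_eq_zero hsym hvan hb hlex hne hle hi
    rwa [hb q, ← min_eq_left hle] at h
end

section
/- Let B be the k×k matrix with B_{ab} = 2min(a,b) + max(a+b−k, 0), and let c be the vector with c_a = max(a − ⌊(k+1)/2⌋, 0). Then the character of (k,3)-admissible configurations with a_0 ≤ ⌊(k+1)/2⌋ equals Σ_{n≥0} z^n Σ_{m_1+2m_2+···+km_k = n} q^{(1/2)(mᵀBm − diag(B)·m) + c·m} / ((q)_{m_1}···(q)_{m_k}). -/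
open PowerSeries

/-- `B_{ab} = 2 min(a,b) + (a+b−k)₊` (with `a, b` the one-based part sizes). -/
def Bmat (k : ℕ) (a b : Fin k) : ℕ :=
  2 * (min (a : ℕ) (b : ℕ) + 1) + (((a : ℕ) + (b : ℕ) + 2) - k)

/-- The exponent `½(mᵀ B m − diag(B)·m) + c·m` with `c_a = (a − ⌊(k+1)/2⌋)₊`, written as
`Σ_{a<b} B_{ab} m_a m_b + Σ_a B_{aa} C(m_a,2) + Σ_a c_a m_a`. -/
def fermiExp3 (k : ℕ) (m : Fin k → ℕ) : ℕ :=
  (∑ pq ∈ Finset.univ.filter (fun pq : Fin k × Fin k => pq.1 < pq.2),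
      Bmat k pq.1 pq.2 * m pq.1 * m pq.2)
  + (∑ a : Fin k, Bmat k a a * Nat.choose (m a) 2)
  + ∑ a : Fin k, (((a : ℕ) + 1) - (k + 1) / 2) * m a

/-- The finite set of multiplicity vectors `m` with `Σ_a a·m_a = n`. -/
def restricted (k n : ℕ) : Finset (Fin k → ℕ) :=
  (Fintype.piFinset fun _ : Fin k => Finset.range (n + 1)).filter
    fun m => ∑ a : Fin k, ((a : ℕ) + 1) * m a = n

namespace Fermi

theorem mem_restricted {k n : ℕ} {m : Fin k → ℕ} :
    m ∈ restricted k n ↔ ∑ a : Fin k, ((a : ℕ) + 1) * m a = n := by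
  simp only [restricted, Finset.mem_filter, Fintype.mem_piFinset, Finset.mem_range,
    and_iff_right_iff_imp]
  intro h a
  have := Finset.single_le_sum (f := fun a : Fin k => ((a : ℕ) + 1) * m a)
    (fun _ _ => Nat.zero_le _) (Finset.mem_univ a)
  simp only [h] at this
  nlinarith

theorem Bmat_comm (k : ℕ) (a b : Fin k) : Bmat k a b = Bmat k b a := by
  simp only [Bmat, min_comm (a : ℕ), add_comm (a : ℕ)]

/-- The quadratic part of `fermiExp3`. -/
def quadExp (k : ℕ) (m : Fin k → ℕ) : ℕ :=
  (∑ pq ∈ Finset.univ.filter (fun pq : Fin k × Fin k => pq.1 < pq.2),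
      Bmat k pq.1 pq.2 * m pq.1 * m pq.2)
  + ∑ a : Fin k, Bmat k a a * Nat.choose (m a) 2

theorem quadExp_add_single (k : ℕ) (m : Fin k → ℕ) (j : Fin k) :
    quadExp k (m + Pi.single j 1 : Fin k → ℕ) = quadExp k m + ∑ i, Bmat k j i * m i := by
  have h1 : ∑ a : Fin k, Bmat k a a * Nat.choose ((m + Pi.single j 1 : Fin k → ℕ) a) 2 =
      ∑ a : Fin k, Bmat k a a * Nat.choose (m a) 2 + Bmat k j j * m j := by
    rw [← Finset.add_sum_erase _ _ (Finset.mem_univ j),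
      ← Finset.add_sum_erase Finset.univ (fun a => Bmat k a a * Nat.choose (m a) 2)
        (Finset.mem_univ j)]
    have : ∀ a ∈ Finset.univ.erase j,
        Bmat k a a * Nat.choose ((m + Pi.single j 1 : Fin k → ℕ) a) 2 =
        Bmat k a a * Nat.choose (m a) 2 := by
      intro a ha
      simp [Pi.single_eq_of_ne (Finset.ne_of_mem_erase ha)]
    rw [Finset.sum_congr rfl this]
    simp [Nat.choose_succ_succ' (m j) 1]
    ring
  have h2 : ∑ pq ∈ Finset.univ.filter (fun pq : Fin k × Fin k => pq.1 < pq.2),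
      Bmat k pq.1 pq.2 * (m + Pi.single j 1 : Fin k → ℕ) pq.1 *
          (m + Pi.single j 1 : Fin k → ℕ) pq.2 =
      (∑ pq ∈ Finset.univ.filter (fun pq : Fin k × Fin k => pq.1 < pq.2),
      Bmat k pq.1 pq.2 * m pq.1 * m pq.2) +
      ∑ i ∈ Finset.univ.erase j, Bmat k j i * m i := by
    simp only [Finset.sum_filter, Fintype.sum_prod_type]
    have e : ∀ x y : Fin k, (if x < y then Bmat k x y * (m + Pi.single j 1 : Fin k → ℕ) x *
        (m + Pi.single j 1 : Fin k → ℕ) y else 0) = (if x < y then Bmat k x y * m x * m y else 0) +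
        ((if x = j then (if j < y then Bmat k j y * m y else 0) else 0) +
          (if y = j then (if x < j then Bmat k j x * m x else 0) else 0)) := by
      intro x y
      by_cases hx : x = j <;> by_cases hy : y = j
      · subst hx; subst hy; simp
      · subst hx
        by_cases h : x < y
        · simp [hy, h]; ring
        · simp [hy, h]
      · subst hy
        by_cases h : x < y
        · simp [hx, h, Bmat_comm k y x]; ring
        · simp [hx, h]
      · simp [hx, hy]
    simp only [e, Finset.sum_add_distrib]
    congr 1
    have e1 : ∑ x : Fin k, ∑ y : Fin k,
        (if x = j then (if j < y then Bmat k j y * m y else 0) else 0) =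
        ∑ y, if j < y then Bmat k j y * m y else 0 := by
      rw [Finset.sum_comm]; simp
    have e2 : ∑ x : Fin k, ∑ y : Fin k,
        (if y = j then (if x < j then Bmat k j x * m x else 0) else 0) =
        ∑ x, if x < j then Bmat k j x * m x else 0 := by
      simp
    rw [e1, e2, ← Finset.sum_add_distrib, ← Finset.filter_ne' Finset.univ j, Finset.sum_filter]
    refine Finset.sum_congr rfl fun i _ => ?_
    rcases lt_trichotomy i j with h | h | h
    · simp [h, h.ne, h.not_gt]
    · simp [h]
    · simp [h, h.ne', h.not_gt]
  rw [quadExp, quadExp, h1, h2,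
    ← Finset.add_sum_erase Finset.univ (fun i => Bmat k j i * m i) (Finset.mem_univ j)]
  ring

variable {K : Type*} [Field K]

/-- The summand of the fermionic sum with linear exponent `u`. -/
noncomputable def fterm (q : K) (k : ℕ) (u : ℤ → ℤ) (m : Fin k → ℕ) : K :=
  q ^ quadExp k m * q ^ (∑ a : Fin k, u ((a : ℕ) + 1) * (m a : ℤ)) *
    (∏ a : Fin k, ∏ j ∈ Finset.range (m a), (1 - q ^ (j + 1)))⁻¹

/-- The fermionic sum with linear exponent `u`, as a power series in `z`. -/
noncomputable def fsum (q : K) (k : ℕ) (u : ℤ → ℤ) : PowerSeries K :=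
  PowerSeries.mk fun n => ∑ m ∈ restricted k n, fterm q k u m

theorem fsum_congr (q : K) (k : ℕ) {u v : ℤ → ℤ} (h : ∀ i : ℤ, 1 ≤ i → i ≤ k → u i = v i) :
    fsum q k u = fsum q k v := by
  have : ∀ a : Fin k, u ((a : ℕ) + 1) = v ((a : ℕ) + 1) := fun a => h _ (by omega) (by omega)
  simp only [fsum, fterm, this]

theorem fterm_add_single {q : K} (hq : q ≠ 0) (hq1 : ∀ n : ℕ, q ^ (n + 1) ≠ 1)
    (k : ℕ) (u : ℤ → ℤ) (m : Fin k → ℕ) (j : Fin k) :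
    fterm q k u (m + Pi.single j 1 : Fin k → ℕ) * (1 - q ^ (m j + 1)) =
      q ^ u ((j : ℕ) + 1) * fterm q k (fun i => u i + (2 * min i ((j : ℕ) + 1) +
        max (i + ((j : ℕ) + 1) - k) 0)) m := by
  have hlin : ∑ a : Fin k, u ((a : ℕ) + 1) * ((m + Pi.single j 1 : Fin k → ℕ) a : ℤ) =
      (∑ a : Fin k, u ((a : ℕ) + 1) * (m a : ℤ)) + u ((j : ℕ) + 1) := by
    simp [mul_add, Finset.sum_add_distrib, Pi.single_apply]
  have hB : ∑ a : Fin k, (u ((a : ℕ) + 1) + (2 * min (((a : ℕ) : ℤ) + 1) ((j : ℕ) + 1) +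
        max (((a : ℕ) : ℤ) + 1 + ((j : ℕ) + 1) - k) 0)) * (m a : ℤ) =
      ((∑ i, Bmat k j i * m i : ℕ) : ℤ) + (∑ a : Fin k, u ((a : ℕ) + 1) * (m a : ℤ)) := by
    push_cast
    rw [← Finset.sum_add_distrib]
    refine Finset.sum_congr rfl fun a _ => ?_
    have : ((Bmat k j a : ℕ) : ℤ) = 2 * min (((a : ℕ) : ℤ) + 1) ((j : ℕ) + 1) +
        max (((a : ℕ) : ℤ) + 1 + ((j : ℕ) + 1) - k) 0 := by
      simp only [Bmat]; omega
    rw [this]; ring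
  have hprod : ∏ a : Fin k, ∏ i ∈ Finset.range ((m + Pi.single j 1 : Fin k → ℕ) a),
      (1 - q ^ (i + 1)) =
      (∏ a : Fin k, ∏ i ∈ Finset.range (m a), (1 - q ^ (i + 1))) * (1 - q ^ (m j + 1)) := by
    rw [← Finset.mul_prod_erase _ _ (Finset.mem_univ j),
      ← Finset.mul_prod_erase Finset.univ (fun a => ∏ i ∈ Finset.range (m a), (1 - q ^ (i + 1)))
        (Finset.mem_univ j)]
    have : ∀ a ∈ Finset.univ.erase j, ∏ i ∈ Finset.range ((m + Pi.single j 1 : Fin k → ℕ) a),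
        (1 - q ^ (i + 1)) = ∏ i ∈ Finset.range (m a), (1 - q ^ (i + 1)) := by
      intro a ha
      simp [Pi.single_eq_of_ne (Finset.ne_of_mem_erase ha)]
    rw [Finset.prod_congr rfl this]
    simp [Finset.prod_range_succ]
    ring
  have hne : (1 - q ^ (m j + 1)) ≠ 0 := sub_ne_zero.2 (hq1 _).symm
  simp only [fterm, quadExp_add_single, hlin, hB, hprod, mul_inv, zpow_add₀ hq, zpow_natCast,
    pow_add _ (quadExp k m)]
  field_simp

theorem fsum_sub {q : K} (hq : q ≠ 0) (hq1 : ∀ n : ℕ, q ^ (n + 1) ≠ 1) (k : ℕ)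
    (u : ℤ → ℤ) (j : Fin k) :
    fsum q k u - fsum q k (fun i => u i + if i = (j : ℕ) + 1 then 1 else 0) =
      C (q ^ u ((j : ℕ) + 1)) * X ^ ((j : ℕ) + 1) *
        fsum q k (fun i => u i + (2 * min i ((j : ℕ) + 1) + max (i + ((j : ℕ) + 1) - k) 0)) := by
  ext n
  have ht : ∀ m : Fin k → ℕ, fterm q k (fun i => u i + if i = (j : ℕ) + 1 then 1 else 0) m =
      fterm q k u m * q ^ (m j) := by
    intro m
    have : ∑ a : Fin k, (u ((a : ℕ) + 1) + if (((a : ℕ) : ℤ) + 1) = (j : ℕ) + 1 then 1 else 0) *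
        (m a : ℤ) = (∑ a : Fin k, u ((a : ℕ) + 1) * (m a : ℤ)) + m j := by
      simp only [add_mul, Finset.sum_add_distrib, add_left_inj, Nat.cast_inj, ite_mul, one_mul,
        zero_mul, Fin.val_inj, Finset.sum_ite_eq', Finset.mem_univ, if_true]
    simp only [fterm, this, zpow_add₀ hq, zpow_natCast]
    ring
  rw [map_sub, mul_assoc, coeff_C_mul, coeff_X_pow_mul']
  simp only [fsum, coeff_mk, ← Finset.sum_sub_distrib, ht]
  have hz : ∀ m ∈ restricted k n, m ∉ (restricted k n).filter (fun m => m j ≠ 0) →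
      fterm q k u m - fterm q k u m * q ^ m j = 0 := by
    intro m hm h
    simp only [Finset.mem_filter, hm, true_and, not_not] at h
    simp [h]
  rw [← Finset.sum_subset (Finset.filter_subset _ _) hz]
  have hw : ∀ m : Fin k → ℕ, ∑ a : Fin k, ((a : ℕ) + 1) * (m + Pi.single j 1 : Fin k → ℕ) a =
      ∑ a : Fin k, ((a : ℕ) + 1) * m a + ((j : ℕ) + 1) := by
    intro m
    simp [mul_add, Finset.sum_add_distrib, Pi.single_apply]
  have hsplit : ∀ m : Fin k → ℕ, m j ≠ 0 → m - Pi.single j 1 + Pi.single j 1 = m := by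
    intro m hm
    ext a
    by_cases h : a = j
    · subst h; simp; omega
    · simp [Pi.single_eq_of_ne h]
  split_ifs with hn
  · rw [Finset.mul_sum]
    symm
    refine Finset.sum_bij' (fun (m : Fin k → ℕ) _ => m + Pi.single j 1)
      (fun (m : Fin k → ℕ) _ => m - Pi.single j 1)
      ?_ ?_ ?_ ?_ ?_
    · intro m hm
      rw [mem_restricted] at hm
      rw [Finset.mem_filter, mem_restricted, hw, hm]
      exact ⟨by omega, by simp⟩
    · intro m hm
      rw [Finset.mem_filter, mem_restricted] at hm
      have := hw (m - Pi.single j 1 : Fin k → ℕ)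
      rw [hsplit m hm.2, hm.1] at this
      rw [mem_restricted]; omega
    · intro m _
      ext a; simp
    · intro m hm
      exact hsplit m (Finset.mem_filter.1 hm).2
    · intro m _
      rw [← fterm_add_single hq hq1]
      simp; ring
  · rw [mul_zero]
    refine Finset.sum_eq_zero fun m hm => ?_
    rw [Finset.mem_filter, mem_restricted] at hm
    have := hw (m - Pi.single j 1 : Fin k → ℕ)
    rw [hsplit m hm.2, hm.1] at this
    omega

end Fermi

namespace Fermi
variable {K : Type*} [Field K]

/-- The exponent vector `i ↦ (i - p)₊`. -/
def L (p i : ℤ) : ℤ := max (i - p) 0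

/-- The fermionic sum attached to an exponent vector on `0, …, k`, with the convention that it
vanishes unless the entry at `0` is zero. -/
noncomputable def F (q : K) (k : ℕ) (u : ℤ → ℤ) : PowerSeries K :=
  if u 0 = 0 then fsum q k u else 0

theorem F_congr (q : K) (k : ℕ) {u v : ℤ → ℤ} (h : ∀ i : ℤ, 0 ≤ i → i ≤ k → u i = v i) :
    F q k u = F q k v := by
  rw [F, F, h 0 le_rfl (by omega), fsum_congr q k fun i hi => h i (by omega)]

theorem F_sub {q : K} (hq : q ≠ 0) (hq1 : ∀ n : ℕ, q ^ (n + 1) ≠ 1) (k : ℕ)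
    {u u' w : ℤ → ℤ} {j : ℕ} (hj : 1 ≤ j) (hjk : j ≤ k) (hu : u 0 = 0)
    (huj : u' j = u j + 1) (hu' : ∀ i : ℤ, 0 ≤ i → i ≤ k → i ≠ j → u' i = u i)
    (hw : ∀ i : ℤ, 0 ≤ i → i ≤ k → w i = u i + (2 * min i j + max (i + j - k) 0)) :
    F q k u - F q k u' = C (q ^ u j) * X ^ j * F q k w := by
  have h0 : u' 0 = 0 := by rw [hu' 0 le_rfl (by omega) (by omega), hu]
  have h1 : w 0 = 0 := by rw [hw 0 le_rfl (by omega), hu]; omega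
  obtain ⟨j, rfl⟩ : ∃ i, j = i + 1 := ⟨j - 1, by omega⟩
  have := fsum_sub hq hq1 k u ⟨j, by omega⟩
  push_cast at huj hu' hw ⊢
  rw [F, F, F, if_pos hu, if_pos h0, if_pos h1]
  convert this using 2
  · refine fsum_congr q k fun i hi hi' => ?_
    split_ifs with h
    · rw [h, huj]
    · rw [hu' i (by omega) hi' h, add_zero]
  · exact fsum_congr q k fun i hi hi' => hw i (by omega) hi'

theorem F_pair {q : K} (hq : q ≠ 0) (hq1 : ∀ n : ℕ, q ^ (n + 1) ≠ 1) (k : ℕ)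
    {u u' v v' : ℤ → ℤ} (j n : ℤ) (hj : 1 ≤ j) (hjk : j ≤ k) (hv : v 0 = 0)
    (huj : u' j = u j + 1) (hu' : ∀ i : ℤ, 0 ≤ i → i ≤ k → i ≠ j → u' i = u i)
    (hvj : v' (j - 1) = v (j - 1) + 1)
    (hv' : ∀ i : ℤ, 0 ≤ i → i ≤ k → i ≠ j - 1 → v' i = v i)
    (huv : ∀ i : ℤ, 0 ≤ i → i ≤ k → u i + (2 * min i j + max (i + j - k) 0) =
      v i + (2 * min i (j - 1) + max (i + (j - 1) - k) 0))
    (hn : n = u j - v (j - 1)) :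
    F q k u - F q k u' = C (q ^ n) * X * (F q k v - F q k v') := by
  have hu : u 0 = 0 := by have := huv 0 le_rfl (by omega); omega
  obtain ⟨j, rfl⟩ : ∃ i : ℕ, j = i + 1 := ⟨(j - 1).toNat, by omega⟩
  simp only [add_sub_cancel_right] at *
  have h1 := F_sub hq hq1 k (j := j + 1)
    (w := fun i => u i + (2 * min i (j + 1) + max (i + (j + 1) - k) 0))
    (by omega) (by omega) hu (by exact_mod_cast huj) (by exact_mod_cast hu')
    (by push_cast; intros; rfl)
  rw [h1]
  push_cast
  subst hn
  rcases Nat.eq_zero_or_pos j with rfl | h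
  · have : v' 0 ≠ 0 := by
      simp at hvj; omega
    rw [F, F, F, if_pos hv, if_neg this, if_pos (by omega)]
    have : fsum q k (fun i => u i + (2 * min i ((0 : ℕ) + 1) + max (i + ((0 : ℕ) + 1) - k) 0)) =
        fsum q k v := by
      refine fsum_congr q k fun i hi hi' => ?_
      have := huv i (by omega) hi'
      omega
    rw [this]
    simp [hv]
  · rw [F_sub hq hq1 k h (by omega) hv hvj hv' huv, zpow_sub₀ hq, div_eq_mul_inv, map_mul]
    have : C (q ^ v j)⁻¹ * C (q ^ v j) = (1 : PowerSeries K) := by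
      rw [← map_mul, inv_mul_cancel₀ (zpow_ne_zero _ hq), map_one]
    linear_combination (-C (q ^ u (j + 1)) * X ^ (j + 1) * F q k _) * this

end Fermi

namespace Fermi
variable {K : Type*} [Field K]

/-- An expression in three fermionic sums that is unchanged when `p` moves along a range on which
the slopes of `V` at `p` and `k - p + 1` are `l` and `h`. -/
noncomputable def E₁ (q : K) (k : ℕ) (V : ℤ → ℤ) (h l p : ℤ) : PowerSeries K :=
  F q k (V + L (p + 1) - L p)
    + C (q ^ (l - 1)) * X * F q k (V + L (p - 1) - L p + L (k - p - 1) - L (k - p))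
    + C (q ^ (l - h + 1)) * F q k (V + L (k - p + 1) - L (k - p))

/-- A companion of `E₁` with the same invariance. -/
noncomputable def E₂ (q : K) (k : ℕ) (V : ℤ → ℤ) (h l p : ℤ) : PowerSeries K :=
  F q k (V + L (p + 1) - L p + L (k - p + 1) - L (k - p))
    + C (q ^ (h - 2)) * X * F q k (V + L (k - p - 1) - L (k - p))
    + C (q ^ (l - 1)) * X * F q k (V + L (p - 1) - L p)

theorem C_zpow_mul {q : K} (hq : q ≠ 0) {a b c : ℤ} (h : a + b = c) :
    C (q ^ a) * C (q ^ b) = (C (q ^ c) : PowerSeries K) := by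
  rw [← map_mul, ← zpow_add₀ hq, h]

variable {q : K} (hq : q ≠ 0) (hq1 : ∀ n : ℕ, q ^ (n + 1) ≠ 1) {k : ℕ}
include hq hq1

theorem E₁_step {V : ℤ → ℤ} {h l p : ℤ} (hV : V 0 = 0) (hp : 1 ≤ p) (hpk : 2 * p ≤ k)
    (hl : V p = V (p - 1) + l) (hh : V (k - p + 1) = V (k - p) + h) :
    E₁ q k V h l (p - 1) = E₁ q k V h l p := by
  have e1 := F_pair hq hq1 k (u := V + L (p - 1 + 1) - L (p - 1)) (u' := V + L (p + 1) - L p)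
    (v := V + L (p - 1) - L p + L (k - p) - L (k - p + 1))
    (v' := V + L (p - 1 - 1) - L (p - 1) + L (k - (p - 1) - 1) - L (k - (p - 1)))
    p (l - 1) hp (by omega)
    (by simp only [Pi.add_apply, Pi.sub_apply, L]; omega)
    (by simp only [Pi.add_apply, Pi.sub_apply, L]; omega)
    (by intro i _ _ _; simp only [Pi.add_apply, Pi.sub_apply, L]; omega)
    (by simp only [Pi.add_apply, Pi.sub_apply, L]; omega)
    (by intro i _ _ _; simp only [Pi.add_apply, Pi.sub_apply, L]; omega)
    (by intro i _ _; simp only [Pi.add_apply, Pi.sub_apply, L]; omega)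
    (by simp only [Pi.add_apply, Pi.sub_apply, L]; omega)
  have e2 := F_pair hq hq1 k (u := V + L (k - p + 1) - L (k - p))
    (u' := V + L (k - (p - 1) + 1) - L (k - (p - 1)))
    (v := V + L (p - 1) - L p + L (k - p) - L (k - p + 1))
    (v' := V + L (p - 1) - L p + L (k - p - 1) - L (k - p))
    (k - p + 1) (h - 2) (by omega) (by omega)
    (by simp only [Pi.add_apply, Pi.sub_apply, L]; omega)
    (by simp only [Pi.add_apply, Pi.sub_apply, L]; omega)
    (by intro i _ _ _; simp only [Pi.add_apply, Pi.sub_apply, L]; omega)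
    (by rw [add_sub_cancel_right]; simp only [Pi.add_apply, Pi.sub_apply, L]; omega)
    (by intro i _ _ _; simp only [Pi.add_apply, Pi.sub_apply, L]; omega)
    (by intro i _ _; simp only [Pi.add_apply, Pi.sub_apply, L]; omega)
    (by rw [add_sub_cancel_right]; simp only [Pi.add_apply, Pi.sub_apply, L]; omega)
  have e3 := C_zpow_mul hq (show (l - h + 1) + (h - 2) = l - 1 by ring)
  rw [E₁, E₁]
  linear_combination e1 - C (q ^ (l - h + 1)) * e2 -
      (X * (F q k (V + L (p - 1) - L p + L (k - p) - L (k - p + 1)) -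
        F q k (V + L (p - 1) - L p + L (k - p - 1) - L (k - p)))) * e3

theorem E₂_step {V : ℤ → ℤ} {h l p : ℤ} (hV : V 0 = 0) (hp : 1 ≤ p) (hpk : 2 * p ≤ k)
    (hl : V p = V (p - 1) + l) (hh : V (k - p + 1) = V (k - p) + h) :
    E₂ q k V h l (p - 1) = E₂ q k V h l p := by
  have e1 := F_pair hq hq1 k (u := V + L p - L (p - 1) + L (k - p + 1) - L (k - p))
    (u' := V + L (p + 1) - L p + L (k - p + 1) - L (k - p))
    (v := V + L (p - 1) - L p)
    (v' := V + L (p - 1 - 1) - L (p - 1))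
    p (l - 1) hp (by omega)
    (by simp only [Pi.add_apply, Pi.sub_apply, L]; omega)
    (by simp only [Pi.add_apply, Pi.sub_apply, L]; omega)
    (by intro i _ _ _; simp only [Pi.add_apply, Pi.sub_apply, L]; omega)
    (by simp only [Pi.add_apply, Pi.sub_apply, L]; omega)
    (by intro i _ _ _; simp only [Pi.add_apply, Pi.sub_apply, L]; omega)
    (by intro i _ _; simp only [Pi.add_apply, Pi.sub_apply, L]; omega)
    (by simp only [Pi.add_apply, Pi.sub_apply, L]; omega)
  have e2 := F_pair hq hq1 k (u := V + L p - L (p - 1) + L (k - p + 1) - L (k - p))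
    (u' := V + L (p - 1 + 1) - L (p - 1) + L (k - (p - 1) + 1) - L (k - (p - 1)))
    (v := V + L (k - (p - 1) - 1) - L (k - (p - 1)))
    (v' := V + L (k - p - 1) - L (k - p))
    (k - p + 1) (h - 2) (by omega) (by omega)
    (by simp only [Pi.add_apply, Pi.sub_apply, L]; omega)
    (by simp only [Pi.add_apply, Pi.sub_apply, L]; omega)
    (by intro i _ _ _; simp only [Pi.add_apply, Pi.sub_apply, L]; omega)
    (by rw [add_sub_cancel_right]; simp only [Pi.add_apply, Pi.sub_apply, L]; omega)
    (by intro i _ _ _; simp only [Pi.add_apply, Pi.sub_apply, L]; omega)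
    (by intro i _ _; simp only [Pi.add_apply, Pi.sub_apply, L]; omega)
    (by rw [add_sub_cancel_right]; simp only [Pi.add_apply, Pi.sub_apply, L]; omega)
  rw [E₂, E₂]
  linear_combination e1 - e2

end Fermi

namespace Fermi
variable {K : Type*} [Field K]
variable {q : K} (hq : q ≠ 0) (hq1 : ∀ n : ℕ, q ^ (n + 1) ≠ 1) {k : ℕ}
include hq hq1

theorem E₁_chain {V : ℤ → ℤ} {h l a b : ℤ} (hV : V 0 = 0) (ha : 0 ≤ a) (hab : a ≤ b)
    (hbk : 2 * b ≤ k) (hl : ∀ p, a < p → p ≤ b → V p = V (p - 1) + l)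
    (hh : ∀ p, a < p → p ≤ b → V (k - p + 1) = V (k - p) + h) :
    E₁ q k V h l a = E₁ q k V h l b := by
  induction b, hab using Int.leInduction with
  | base => rfl
  | succ b hb ih =>
    rw [ih (by omega) (fun p h1 h2 => hl p h1 (by omega)) (fun p h1 h2 => hh p h1 (by omega)),
      ← E₁_step hq hq1 hV (by omega) hbk (hl _ (by omega) le_rfl) (hh _ (by omega) le_rfl),
      add_sub_cancel_right]

theorem E₂_chain {V : ℤ → ℤ} {h l a b : ℤ} (hV : V 0 = 0) (ha : 0 ≤ a) (hab : a ≤ b)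
    (hbk : 2 * b ≤ k) (hl : ∀ p, a < p → p ≤ b → V p = V (p - 1) + l)
    (hh : ∀ p, a < p → p ≤ b → V (k - p + 1) = V (k - p) + h) :
    E₂ q k V h l a = E₂ q k V h l b := by
  induction b, hab using Int.leInduction with
  | base => rfl
  | succ b hb ih =>
    rw [ih (by omega) (fun p h1 h2 => hl p h1 (by omega)) (fun p h1 h2 => hh p h1 (by omega)),
      ← E₂_step hq hq1 hV (by omega) hbk (hl _ (by omega) le_rfl) (hh _ (by omega) le_rfl),
      add_sub_cancel_right]

omit hq hq1 in
theorem F_eq_zero {u : ℤ → ℤ} (h : u 0 ≠ 0) : F q k u = 0 := if_neg h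

omit hq hq1 in
theorem E₁_zero {V : ℤ → ℤ} {h l : ℤ} (hk : 1 ≤ k) (hV : V 0 = 0) :
    E₁ q k V h l 0 = F q k (V + L 1 - L 0) + C (q ^ (l - h + 1)) * F q k V := by
  rw [E₁, F_eq_zero (u := V + L (0 - 1) - L 0 + L (k - 0 - 1) - L (k - 0))
      (by simp only [Pi.add_apply, Pi.sub_apply, L]; omega), mul_zero, add_zero, zero_add,
    F_congr q k (u := V + L (k - 0 + 1) - L (k - 0)) (v := V)
      (by intro i _ _; simp only [Pi.add_apply, Pi.sub_apply, L]; omega)]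

omit hq hq1 in
theorem E₂_zero {V : ℤ → ℤ} {h l : ℤ} (hV : V 0 = 0) :
    E₂ q k V h l 0 =
      F q k (V + L 1 - L 0) + C (q ^ (h - 2)) * X * F q k (V + L (k - 1)) := by
  rw [E₂, F_eq_zero (u := V + L (0 - 1) - L 0)
      (by simp only [Pi.add_apply, Pi.sub_apply, L]; omega), mul_zero, add_zero, zero_add,
    F_congr q k (u := V + L 1 - L 0 + L (k - 0 + 1) - L (k - 0)) (v := V + L 1 - L 0)
      (by intro i _ _; simp only [Pi.add_apply, Pi.sub_apply, L]; omega),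
    F_congr q k (u := V + L (k - 0 - 1) - L (k - 0)) (v := V + L (k - 1))
      (by intro i _ _; simp only [Pi.add_apply, Pi.sub_apply, L]; omega)]

theorem E₁_eq_low {w : ℤ → ℤ} {h l c : ℤ} (hw : w 0 = 0) (hc : 1 ≤ c) (hck : 2 * c ≤ k)
    (hh : w (k - c + 1) = w (k - c) + (h - 1)) :
    E₁ q k (w + L c) h l c - F q k (w + L (c + 1)) = C (q ^ (l - h + 1)) *
      (E₂ q k (w + L (c - 1)) h l (c - 1) - C (q ^ (l - 1)) * X * F q k (w + L (c - 2))) := by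
  have e := F_pair hq hq1 k (u := w + L c + L (k - c + 1) - L (k - c))
    (u' := w + L (c - 1) + L (c - 1 + 1) - L (c - 1) + L (k - (c - 1) + 1) - L (k - (c - 1)))
    (v := w + L (c - 1) + L (k - (c - 1) - 1) - L (k - (c - 1)))
    (v' := w + L c + L (c - 1) - L c + L (k - c - 1) - L (k - c))
    (k - c + 1) (h - 2) (by omega) (by omega)
    (by simp only [Pi.add_apply, Pi.sub_apply, L]; omega)
    (by simp only [Pi.add_apply, Pi.sub_apply, L]; omega)
    (by intro i _ _ _; simp only [Pi.add_apply, Pi.sub_apply, L]; omega)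
    (by rw [add_sub_cancel_right]; simp only [Pi.add_apply, Pi.sub_apply, L]; omega)
    (by intro i _ _ _; simp only [Pi.add_apply, Pi.sub_apply, L]; omega)
    (by intro i _ _; simp only [Pi.add_apply, Pi.sub_apply, L]; omega)
    (by rw [add_sub_cancel_right]; simp only [Pi.add_apply, Pi.sub_apply, L]; omega)
  have e3 := C_zpow_mul hq (show (l - h + 1) + (h - 2) = l - 1 by ring)
  rw [E₁, E₂, F_congr q k (u := w + L c + L (c + 1) - L c) (v := w + L (c + 1))
      (by intro i _ _; simp only [Pi.add_apply, Pi.sub_apply, L]; omega),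
    F_congr q k (u := w + L (c - 1) + L (c - 1 - 1) - L (c - 1)) (v := w + L (c - 2))
      (by intro i _ _; simp only [Pi.add_apply, Pi.sub_apply, L]; omega)]
  linear_combination C (q ^ (l - h + 1)) * e -
    X * F q k (w + L c + L (c - 1) - L c + L (k - c - 1) - L (k - c)) * e3

theorem E₁_eq_high {w : ℤ → ℤ} {h l c : ℤ} (hw : w 0 = 0) (hc : k < 2 * c) (hck : c ≤ k)
    (hh : w c = w (c - 1) + (h - 1)) :
    E₁ q k (w + L c) h l (k - c) - C (q ^ (l - h + 1)) * F q k (w + L (c + 1)) =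
      E₂ q k (w + L (c - 1)) h l (k - c) - C (q ^ (h - 2)) * X * F q k (w + L (c - 2)) := by
  have e := F_pair hq hq1 k (u := w + L c + L (k - c + 1) - L (k - c))
    (u' := w + L (c - 1) + L (k - c + 1) - L (k - c) + L (k - (k - c) + 1) - L (k - (k - c)))
    (v := w + L (c - 1) + L (k - (k - c) - 1) - L (k - (k - c)))
    (v' := w + L (c - 2))
    c (h - 2) (by omega) (by omega)
    (by simp only [Pi.add_apply, Pi.sub_apply, L]; omega)
    (by simp only [Pi.add_apply, Pi.sub_apply, L]; omega)
    (by intro i _ _ _; simp only [Pi.add_apply, Pi.sub_apply, L]; omega)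
    (by simp only [Pi.add_apply, Pi.sub_apply, L]; omega)
    (by intro i _ _ _; simp only [Pi.add_apply, Pi.sub_apply, L]; omega)
    (by intro i _ _; simp only [Pi.add_apply, Pi.sub_apply, L]; omega)
    (by simp only [Pi.add_apply, Pi.sub_apply, L]; omega)
  rw [E₁, E₂, F_congr q k (u := w + L c + L (k - (k - c) + 1) - L (k - (k - c)))
      (v := w + L (c + 1))
      (by intro i _ _; simp only [Pi.add_apply, Pi.sub_apply, L]; omega),
    F_congr q k
      (u := w + L c + L (k - c - 1) - L (k - c) + L (k - (k - c) - 1) - L (k - (k - c)))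
      (v := w + L (c - 1) + L (k - c - 1) - L (k - c))
      (by intro i _ _; simp only [Pi.add_apply, Pi.sub_apply, L]; omega)]
  linear_combination e

omit hq hq1 in
theorem E₁_cross_high {w : ℤ → ℤ} {h l h' c : ℤ} :
    E₁ q k (w + L c) h' l (k - c) = E₁ q k (w + L c) h l (k - c) +
      (C (q ^ (l - h' + 1)) - C (q ^ (l - h + 1))) * F q k (w + L (c + 1)) := by
  rw [E₁, E₁, F_congr q k (u := w + L c + L (k - (k - c) + 1) - L (k - (k - c)))
      (v := w + L (c + 1))
      (by intro i _ _; simp only [Pi.add_apply, Pi.sub_apply, L]; omega)]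
  ring

omit hq hq1 in
theorem E₂_cross_high {w : ℤ → ℤ} {h l h' c : ℤ} :
    E₂ q k (w + L c) h' l (k - c) = E₂ q k (w + L c) h l (k - c) +
      (C (q ^ (h' - 2)) - C (q ^ (h - 2))) * X * F q k (w + L (c - 1)) := by
  rw [E₂, E₂, F_congr q k (u := w + L c + L (k - (k - c) - 1) - L (k - (k - c)))
      (v := w + L (c - 1))
      (by intro i _ _; simp only [Pi.add_apply, Pi.sub_apply, L]; omega)]
  ring

omit hq1 in
theorem E₁_cross_low {w : ℤ → ℤ} {h l l' c : ℤ} (hl : l' = l + 1) :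
    E₁ q k (w + L c) h l' c =
      C q * E₁ q k (w + L c) h l c - (C q - 1) * F q k (w + L (c + 1)) := by
  have e1 := C_zpow_mul hq (show 1 + (l - 1) = l' - 1 by omega)
  have e2 := C_zpow_mul hq (show 1 + (l - h + 1) = l' - h + 1 by omega)
  rw [zpow_one] at e1 e2
  rw [E₁, E₁, F_congr q k (u := w + L c + L (c + 1) - L c)
      (v := w + L (c + 1))
      (by intro i _ _; simp only [Pi.add_apply, Pi.sub_apply, L]; omega), ← e1, ← e2]
  ring

omit hq hq1 in
theorem E₂_cross_low {w : ℤ → ℤ} {h l l' c : ℤ} :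
    E₂ q k (w + L c) h l' c = E₂ q k (w + L c) h l c +
      (C (q ^ (l' - 1)) - C (q ^ (l - 1))) * X * F q k (w + L (c - 1)) := by
  rw [E₂, E₂, F_congr q k (u := w + L c + L (c - 1) - L c)
      (v := w + L (c - 1))
      (by intro i _ _; simp only [Pi.add_apply, Pi.sub_apply, L]; omega)]
  ring

end Fermi

namespace Fermi
variable {K : Type*} [Field K]
variable {q : K} (hq : q ≠ 0) (hq1 : ∀ n : ℕ, q ^ (n + 1) ≠ 1) {k : ℕ}
include hq hq1

theorem LA_le {a b : ℤ} (ha : 1 ≤ a) (hab : a ≤ b) (habk : a + b ≤ k) :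
    F q k (L b + L a + L 1 - L 0) + C q⁻¹ * F q k (L b + L a) - F q k (L b + L (a + 1)) =
      C q⁻¹ * (F q k (L b + L (a - 1) + L 1 - L 0)
        + X * F q k (L b + L (a - 1) + L (k - 1))
        - C q⁻¹ * X * F q k (L b + L (a - 2))) := by
  have h0 : (L b + L a) 0 = 0 := by simp only [Pi.add_apply, L]; omega
  have h0' : (L b + L (a - 1)) 0 = 0 := by simp only [Pi.add_apply, L]; omega
  have e1 := E₁_chain hq hq1 (k := k) (h := 2) (l := 0) (a := 0) (b := a) h0 le_rfl (by omega)
      (by omega)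
    (by intro p _ _; simp only [Pi.add_apply, L]; omega)
    (by intro p _ _; simp only [Pi.add_apply, L]; omega)
  have e2 := E₂_chain hq hq1 (k := k) (h := 2) (l := 0) (a := 0) (b := a - 1) h0' le_rfl (by omega)
    (by omega)
    (by intro p _ _; simp only [Pi.add_apply, L]; omega)
    (by intro p _ _; simp only [Pi.add_apply, L]; omega)
  have e3 := E₁_eq_low hq hq1 (k := k) (w := L b) (h := 2) (l := 0) (c := a)
    (by simp only [L]; omega) ha (by omega) (by simp only [L]; omega)
  rw [← e1, ← e2, E₁_zero (by omega) h0, E₂_zero h0'] at e3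
  norm_num at e3 ⊢
  exact e3

theorem LA_gt {a b : ℤ} (ha : 1 ≤ a) (hab : a ≤ b) (hb : b ≤ k) (habk : k < a + b) :
    F q k (L b + L a + L 1 - L 0) + C q⁻¹ * F q k (L b + L a)
        + (1 - C q⁻¹) * F q k (L a + L (b + 1)) - F q k (L b + L (a + 1)) =
      F q k (L b + L (a - 1) + L 1 - L 0) + X * F q k (L b + L (a - 1) + L (k - 1))
        - X * (1 - C q⁻¹) * F q k (L (a - 1) + L (b - 1))
        - C q⁻¹ * X * F q k (L b + L (a - 2)) := by
  have h0 : (L b + L a) 0 = 0 := by simp only [Pi.add_apply, L]; omega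
  have h0' : (L b + L (a - 1)) 0 = 0 := by simp only [Pi.add_apply, L]; omega
  have e1 := E₁_chain hq hq1 (k := k) (h := 2) (l := 0) (a := 0) (b := k - b) h0 le_rfl
    (by omega) (by omega)
    (by intro p _ _; simp only [Pi.add_apply, L]; omega)
    (by intro p _ _; simp only [Pi.add_apply, L]; omega)
  have e2 := E₂_chain hq hq1 (k := k) (h := 2) (l := 0) (a := 0) (b := k - b) h0' le_rfl
    (by omega) (by omega)
    (by intro p _ _; simp only [Pi.add_apply, L]; omega)
    (by intro p _ _; simp only [Pi.add_apply, L]; omega)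
  have c1 := E₁_cross_high (q := q) (k := k) (w := L a) (h := 2) (l := 0) (h' := 1) (c := b)
  have c2 := E₂_cross_high (q := q) (k := k) (w := L (a - 1)) (h := 2) (l := 0) (h' := 1) (c := b)
  rw [add_comm (L a) (L b), ← e1, E₁_zero (by omega) h0] at c1
  rw [add_comm (L (a - 1)) (L b), ← e2, E₂_zero h0'] at c2
  rcases le_or_gt (2 * a) k with h | h
  · have e3 := E₁_eq_low hq hq1 (k := k) (w := L b) (h := 1) (l := 0) (c := a)
      (by simp only [L]; omega) ha (by omega) (by simp only [L]; omega)
    rw [← E₁_chain hq hq1 (k := k) (a := k - b) h0 (by omega) (by omega) (by omega)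
        (by intro p _ _; simp only [Pi.add_apply, L]; omega)
        (by intro p _ _; simp only [Pi.add_apply, L]; omega), c1,
      ← E₂_chain hq hq1 (k := k) (a := k - b) h0' (by omega) (by omega) (by omega)
        (by intro p _ _; simp only [Pi.add_apply, L]; omega)
        (by intro p _ _; simp only [Pi.add_apply, L]; omega), c2] at e3
    norm_num at e3 ⊢
    linear_combination e3
  · have e3 := E₁_eq_high hq hq1 (k := k) (w := L b) (h := 1) (l := 0) (c := a)
      (by simp only [L]; omega) h (by omega) (by simp only [L]; omega)
    rw [← E₁_chain hq hq1 (k := k) (a := k - b) h0 (by omega) (by omega) (by omega)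
        (by intro p _ _; simp only [Pi.add_apply, L]; omega)
        (by intro p _ _; simp only [Pi.add_apply, L]; omega), c1,
      ← E₂_chain hq hq1 (k := k) (a := k - b) h0' (by omega) (by omega) (by omega)
        (by intro p _ _; simp only [Pi.add_apply, L]; omega)
        (by intro p _ _; simp only [Pi.add_apply, L]; omega), c2] at e3
    norm_num at e3 ⊢
    linear_combination e3

theorem LB_le {a b : ℤ} (ha : 0 ≤ a) (hab : a < b) (habk : a + b ≤ k) :
    C q * F q k (L a + L b + L 1 - L 0) + F q k (L a + L b)
        - (C q - 1) * F q k (L b + L (a + 1)) - F q k (L a + L (b + 1)) =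
      F q k (L a + L (b - 1) + L 1 - L 0) + X * F q k (L a + L (b - 1) + L (k - 1))
        + X * (1 - C q⁻¹) * F q k (L (b - 1) + L (a - 1))
        - X * F q k (L a + L (b - 2)) := by
  have h0 : (L a + L b) 0 = 0 := by simp only [Pi.add_apply, L]; omega
  have h0' : (L a + L (b - 1)) 0 = 0 := by simp only [Pi.add_apply, L]; omega
  have e1 := E₁_chain hq hq1 (k := k) (h := 2) (l := 0) (a := 0) (b := a) h0 le_rfl
    (by omega) (by omega)
    (by intro p _ _; simp only [Pi.add_apply, L]; omega)
    (by intro p _ _; simp only [Pi.add_apply, L]; omega)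
  have e2 := E₂_chain hq hq1 (k := k) (h := 2) (l := 0) (a := 0) (b := a) h0' le_rfl
    (by omega) (by omega)
    (by intro p _ _; simp only [Pi.add_apply, L]; omega)
    (by intro p _ _; simp only [Pi.add_apply, L]; omega)
  have c1 := E₁_cross_low hq (k := k) (w := L b) (h := 2) (l := 0) (l' := 1) (c := a) rfl
  have c2 := E₂_cross_low (q := q) (k := k) (w := L (b - 1)) (h := 2) (l := 0) (l' := 1) (c := a)
  rw [add_comm (L b) (L a), ← e1, E₁_zero (by omega) h0] at c1
  rw [add_comm (L (b - 1)) (L a), ← e2, E₂_zero h0'] at c2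
  have hQ : C q * C q⁻¹ = (1 : PowerSeries K) := by rw [← map_mul, mul_inv_cancel₀ hq, map_one]
  rcases le_or_gt (2 * b) k with h | h
  · have e3 := E₁_eq_low hq hq1 (k := k) (w := L a) (h := 2) (l := 1) (c := b)
      (by simp only [L]; omega) (by omega) (by omega) (by simp only [L]; omega)
    rw [← E₁_chain hq hq1 (k := k) (a := a) h0 (by omega) (by omega) (by omega)
        (by intro p _ _; simp only [Pi.add_apply, L]; omega)
        (by intro p _ _; simp only [Pi.add_apply, L]; omega), c1,
      ← E₂_chain hq hq1 (k := k) (a := a) h0' (by omega) (by omega) (by omega)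
        (by intro p _ _; simp only [Pi.add_apply, L]; omega)
        (by intro p _ _; simp only [Pi.add_apply, L]; omega), c2] at e3
    norm_num at e3 ⊢
    linear_combination e3 - F q k (L a + L b) * hQ
  · have e3 := E₁_eq_high hq hq1 (k := k) (w := L a) (h := 2) (l := 1) (c := b)
      (by simp only [L]; omega) h (by omega) (by simp only [L]; omega)
    rw [← E₁_chain hq hq1 (k := k) (a := a) h0 (by omega) (by omega) (by omega)
        (by intro p _ _; simp only [Pi.add_apply, L]; omega)
        (by intro p _ _; simp only [Pi.add_apply, L]; omega), c1,
      ← E₂_chain hq hq1 (k := k) (a := a) h0' (by omega) (by omega) (by omega)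
        (by intro p _ _; simp only [Pi.add_apply, L]; omega)
        (by intro p _ _; simp only [Pi.add_apply, L]; omega), c2] at e3
    norm_num at e3 ⊢
    linear_combination e3 - F q k (L a + L b) * hQ

theorem LB_ge {a b : ℤ} (ha : 0 ≤ a) (hab : a < b) (hb : b ≤ k) (habk : k ≤ a + b) :
    F q k (L a + L b + L 1 - L 0) + C q⁻¹ * F q k (L a + L b)
        - C q⁻¹ * F q k (L a + L (b + 1)) =
      F q k (L a + L (b - 1) + L 1 - L 0) + X * F q k (L a + L (b - 1) + L (k - 1))
        - X * F q k (L a + L (b - 2)) := by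
  have h0 : (L a + L b) 0 = 0 := by simp only [Pi.add_apply, L]; omega
  have h0' : (L a + L (b - 1)) 0 = 0 := by simp only [Pi.add_apply, L]; omega
  have e1 := E₁_chain hq hq1 (k := k) (h := 2) (l := 0) (a := 0) (b := k - b) h0 le_rfl
    (by omega) (by omega)
    (by intro p _ _; simp only [Pi.add_apply, L]; omega)
    (by intro p _ _; simp only [Pi.add_apply, L]; omega)
  have e2 := E₂_chain hq hq1 (k := k) (h := 2) (l := 0) (a := 0) (b := k - b) h0' le_rfl
    (by omega) (by omega)
    (by intro p _ _; simp only [Pi.add_apply, L]; omega)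
    (by intro p _ _; simp only [Pi.add_apply, L]; omega)
  have e3 := E₁_eq_high hq hq1 (k := k) (w := L a) (h := 2) (l := 0) (c := b)
    (by simp only [L]; omega) (by omega) (by omega) (by simp only [L]; omega)
  rw [← e1, ← e2, E₁_zero (by omega) h0, E₂_zero h0'] at e3
  norm_num at e3 ⊢
  linear_combination e3

end Fermi

namespace Fermi
variable {K : Type*} [Field K]

theorem L_add_comm (a b : ℤ) : L a + L b = L b + L a := add_comm _ _

/-- The difference of fermionic sums satisfying a closed system of recursions. -/
noncomputable def Δ (q : K) (k : ℕ) (a b : ℤ) : PowerSeries K :=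
  F q k (L a + L b) - F q k (L (a - 1) + L (b + 1))

/-- The same as `Δ`, with `z` replaced by `q ^ s * z`. -/
noncomputable def Δs (q : K) (k : ℕ) (s : ℤ) (a b : ℤ) : PowerSeries K :=
  F q k (L a + L b + s • L 0) - F q k (L (a - 1) + L (b + 1) + s • L 0)

variable {q : K} (hq : q ≠ 0) (hq1 : ∀ n : ℕ, q ^ (n + 1) ≠ 1) {k : ℕ}
include hq hq1

theorem F_top {a b : ℤ} (hk : 1 ≤ k) (ha : 0 ≤ a) (hak : a ≤ k) (hb : 0 ≤ b) (hbk : b ≤ k) :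
    F q k (L a + L b + L (k - 1)) = F q k (L a + L b) -
      C (q ^ (2 * k - a - b)) * X ^ k * F q k (L a + L b + (3 : ℤ) • L 0) := by
  have := F_sub hq hq1 k (u := L a + L b) (u' := L a + L b + L (k - 1))
    (w := L a + L b + (3 : ℤ) • L 0) hk le_rfl
    (by simp only [Pi.add_apply, L]; omega)
    (by simp only [Pi.add_apply, L]; omega)
    (by intro i _ _ _; simp only [Pi.add_apply, L]; omega)
    (by intro i _ _; simp only [Pi.add_apply, Pi.smul_apply, smul_eq_mul, L]; omega)
  rw [show (L a + L b) k = 2 * k - a - b by simp only [Pi.add_apply, L]; omega] at this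
  linear_combination -this

theorem Δ_rec {a b : ℤ} (ha : 1 ≤ a) (hab : a ≤ b) (hbk : b + 1 ≤ k) :
    Δ q k a (b + 1) + C q * Δ q k (a + 1) b + X * Δ q k (a - 1) (b - 1) - Δ q k a b
      - C q * Δ q k (a + 1) (b + 1) - X * Δ q k (a - 1) b - C q * X * Δ q k a (b - 1)
      + C q * X * Δ q k a b =
    C (q ^ (2 * k - a - b + 1)) * X ^ (k + 1) * Δs q k 3 a b := by
  have hQ : C q * C q⁻¹ = (1 : PowerSeries K) := by rw [← map_mul, mul_inv_cancel₀ hq, map_one]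
  have hQ' : C (q ^ (2 * k - a - b + 1)) = (C (q ^ (2 * k - a - b)) * C q : PowerSeries K) := by
    rw [zpow_add₀ hq, map_mul, zpow_one]
  have p1 := F_top hq hq1 (k := k) (a := a - 1) (b := b + 1) (by omega) (by omega) (by omega)
    (by omega) (by omega)
  have p2 := F_top hq hq1 (k := k) (a := a) (b := b) (by omega) (by omega) (by omega)
    (by omega) (by omega)
  rw [show (2 : ℤ) * k - (a - 1) - (b + 1) = 2 * k - a - b by ring] at p1
  have n1 : a - 1 - 1 = a - 2 := by ring
  have n2 : b + 1 + 1 = b + 2 := by ring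
  have n3 : b + 1 - 2 = b - 1 := by ring
  rw [hQ']
  simp only [Δ, Δs]
  generalize (C (q ^ (2 * k - a - b)) : PowerSeries K) = R at *
  generalize hS : (X : PowerSeries K) ^ (k + 1) = S
  rw [pow_succ] at hS
  rcases lt_trichotomy (a + b) k with h | h | h
  · have e1 := LA_le hq hq1 (k := k) (a := a) (b := b + 1) (by omega) (by omega) (by omega)
    have e2 := LB_le hq hq1 (k := k) (a := a) (b := b + 1) (by omega) (by omega) (by omega)
    have e3 := LA_le hq hq1 (k := k) (a := a) (b := b) (by omega) (by omega) (by omega)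
    have e4 := LB_le hq hq1 (k := k) (a := a - 1) (b := b + 1) (by omega) (by omega) (by omega)
    rw [← hS]
    simp only [add_sub_cancel_right, sub_add_cancel, n1, n2, n3, L_add_comm (b + 1),
      L_add_comm b, p1, p2] at e1 e2 e3 e4 ⊢
    linear_combination C q * (C q * e1 - e2 - e3 + C q⁻¹ * e4) + (C q * X * F q k (L (a - 1) + L
        (b + 1)) - C q * R * X * X ^ k * F q k (L (a - 1) + L (b + 1) + (3 : ℤ) • L 0) - C q *
        C q⁻¹ * X * F q k (L (a - 2) + L (b + 1)) + X * F q k (L (a - 1) + L b) + F q k (L a +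
        L b) - F q k (L (a - 1) + L (b + 1)) - F q k (L a + L (b + 1)) + F q k (L (a - 1) + L
        (b + 2)) + X * F q k (L (a - 2) + L b) - X * F q k (L (a - 1) + L (b - 1)) - X * F q k
        (L (a - 2) + L (b + 1))) * hQ
  · have e1 := LA_gt hq hq1 (k := k) (a := a) (b := b + 1) (by omega) (by omega) (by omega)
        (by omega)
    have e2 := LB_ge hq hq1 (k := k) (a := a) (b := b + 1) (by omega) (by omega) (by omega)
        (by omega)
    have e3 := LA_le hq hq1 (k := k) (a := a) (b := b) (by omega) (by omega) (by omega)
    have e4 := LB_le hq hq1 (k := k) (a := a - 1) (b := b + 1) (by omega) (by omega) (by omega)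
    rw [← hS]
    simp only [add_sub_cancel_right, sub_add_cancel, n1, n2, n3, L_add_comm (b + 1),
      L_add_comm b, p1, p2] at e1 e2 e3 e4 ⊢
    linear_combination C q * (e1 - e2 - e3 + C q⁻¹ * e4) + (X * F q k (L (a - 1) + L b) - X * F q
        k (L (a - 2) + L (b + 1)) + F q k (L a + L b) - C q * F q k (L (a - 1) + L (b + 1) + L
        1 - L 0) - F q k (L (a - 1) + L (b + 1)) + C q * F q k (L a + L (b + 1)) - F q k (L a
        + L (b + 1)) + F q k (L (a - 1) + L (b + 2)) + X * F q k (L (a - 2) + L b) - X * F q k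
        (L (a - 1) + L (b - 1))) * hQ
  · have e1 := LA_gt hq hq1 (k := k) (a := a) (b := b + 1) (by omega) (by omega) (by omega)
        (by omega)
    have e2 := LB_ge hq hq1 (k := k) (a := a) (b := b + 1) (by omega) (by omega) (by omega)
        (by omega)
    have e3 := LA_gt hq hq1 (k := k) (a := a) (b := b) (by omega) (by omega) (by omega) (by omega)
    have e4 := LB_ge hq hq1 (k := k) (a := a - 1) (b := b + 1) (by omega) (by omega) (by omega)
        (by omega)
    rw [← hS]
    simp only [add_sub_cancel_right, sub_add_cancel, n1, n2, n3, L_add_comm (b + 1),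
      L_add_comm b, p1, p2] at e1 e2 e3 e4 ⊢
    linear_combination C q * (e1 - e2 - e3 + e4) + (X * F q k (L (a - 1) + L b) - X * F q k (L (a
        - 2) + L (b + 1)) + F q k (L a + L b) - F q k (L a + L (b + 1)) - X * F q k (L (a - 1)
        + L (b - 1)) + X * F q k (L (a - 2) + L b) - F q k (L (a - 1) + L (b + 1)) + F q k (L
        (a - 1) + L (b + 2))) * hQ

end Fermi

namespace Fermi
variable {K : Type*} [Field K]

section rescale
variable {q : K} (hq : q ≠ 0) {k : ℕ}
include hq

theorem rescale_F (s : ℕ) (u : ℤ → ℤ) :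
    rescale (q ^ s) (F q k u) = F q k (u + (s : ℤ) • L 0) := by
  have h0 : (u + (s : ℤ) • L 0) 0 = u 0 := by simp [L]
  rw [F, F, h0]
  split_ifs
  · ext n
    simp only [coeff_rescale, fsum, coeff_mk, Finset.mul_sum]
    refine Finset.sum_congr rfl fun m hm => ?_
    have : ∑ a : Fin k, (u + (s : ℤ) • L 0) ((a : ℕ) + 1) * (m a : ℤ) =
        (∑ a : Fin k, u ((a : ℕ) + 1) * (m a : ℤ)) + ((s * n : ℕ) : ℤ) := by
      rw [← mem_restricted.1 hm]
      push_cast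
      rw [Finset.mul_sum, ← Finset.sum_add_distrib]
      refine Finset.sum_congr rfl fun a _ => ?_
      simp only [Pi.add_apply, Pi.smul_apply, smul_eq_mul, L, sub_zero]
      rw [max_eq_left (by omega)]
      ring
    rw [fterm, fterm, this, zpow_add₀ hq, zpow_natCast, pow_mul]
    ring
  · simp

theorem rescale_Δ (s : ℕ) (a b : ℤ) : rescale (q ^ s) (Δ q k a b) = Δs q k s a b := by
  rw [Δ, Δs, map_sub, rescale_F hq, rescale_F hq]

end rescale

theorem rescale_C (a r : K) : rescale a (C r) = (C r : PowerSeries K) := by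
  ext n
  rw [coeff_rescale, coeff_C]
  split_ifs with h <;> simp [h]

theorem Δ_self (q : K) (k : ℕ) (a : ℤ) : Δ q k a (a - 1) = 0 := by
  rw [Δ, sub_add_cancel, add_comm, sub_self]

theorem Δ_top (q : K) (k : ℕ) {a : ℤ} : Δ q k a k = F q k (L a) - F q k (L (a - 1)) := by
  rw [Δ]
  congr 1 <;> refine F_congr q k fun i _ _ => ?_ <;> simp only [Pi.add_apply, L] <;> omega

/-- The defect in the recursion `Δ a b - Δ a (b - 1) = z ^ a * (Δ (b - a) (k - a))(qz)`. -/
noncomputable def defect (q : K) (k a b : ℕ) : PowerSeries K :=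
  Δ q k a b - Δ q k a (b - 1) - X ^ a * rescale q (Δ q k (b - a) (k - a))

variable {q : K} (hq : q ≠ 0) (hq1 : ∀ n : ℕ, q ^ (n + 1) ≠ 1) {k : ℕ}
include hq hq1

omit hq1 in
theorem defect_zero {b : ℕ} : defect q k 0 b = 0 := by
  have h := rescale_Δ hq (k := k) 1 b k
  rw [pow_one] at h
  rw [defect, Nat.cast_zero, sub_zero, sub_zero, h, Δ, Δ, Δs, pow_zero, one_mul,
    F_eq_zero (u := L (0 - 1) + L (b + 1)) (by simp only [Pi.add_apply, L]; omega),
    F_eq_zero (u := L (0 - 1) + L (b - 1 + 1)) (by simp only [Pi.add_apply, L]; omega),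
    F_congr q k (u := L b + L k + ((1 : ℕ) : ℤ) • L 0) (v := L 0 + L b)
      (by intro i _ _; simp only [Pi.add_apply, Pi.smul_apply, smul_eq_mul, L]; omega),
    F_congr q k (u := L (b - 1) + L (k + 1) + ((1 : ℕ) : ℤ) • L 0) (v := L 0 + L (b - 1))
      (by intro i _ _; simp only [Pi.add_apply, Pi.smul_apply, smul_eq_mul, L]; omega)]
  ring

theorem defect_self {b : ℕ} (hb : b ≤ k) : defect q k b b = 0 := by
  rcases Nat.eq_zero_or_pos b with rfl | h0
  · exact defect_zero hq
  have h := rescale_Δ hq (k := k) 1 0 (k - b)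
  rw [pow_one] at h
  have e := F_sub hq hq1 k (u := L b + L b) (u' := L (b - 1) + L (b + 1))
    (w := L 0 + L (k - b) + ((1 : ℕ) : ℤ) • L 0) h0 hb
    (by simp only [Pi.add_apply, L]; omega)
    (by simp only [Pi.add_apply, L]; omega)
    (by intro i _ _ _; simp only [Pi.add_apply, L]; omega)
    (by intro i _ _; simp only [Pi.add_apply, Pi.smul_apply, smul_eq_mul, L]; omega)
  rw [show (L b + L b) b = 0 by simp only [Pi.add_apply, L]; omega] at e
  rw [defect, Δ_self, sub_self, h, Δ, Δs, e,
    F_eq_zero (u := L (0 - 1) + L (k - b + 1) + ((1 : ℕ) : ℤ) • L 0)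
      (by simp only [Pi.add_apply, Pi.smul_apply, smul_eq_mul, L]; omega)]
  simp

theorem defect_rec {a m r : ℕ} (hr : 1 ≤ r) (hk : a + 1 + m + r = k) :
    defect q k (a + 1) (a + 1 + m + 1) = C q * defect q k (a + 2) (a + 1 + m + 1)
      + X * defect q k a (a + 1 + m) - C q * X * defect q k (a + 1) (a + 1 + m)
      + X ^ (a + 1) * rescale q (defect q k (m + 1) (m + r + 1))
      - C q * X ^ (a + 2) * rescale q (defect q k m (m + r))
      - C (q ^ (m + 1)) * X ^ (a + 1 + m + 1) *
        rescale q (rescale q (defect q k r (a + 1 + r))) := by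
  have h := Δ_rec hq hq1 (k := k) (a := a + 1) (b := a + 1 + m) (by omega) (by omega) (by omega)
  have h3 := rescale_Δ hq (k := k) 3 (a + 1) (a + 1 + m)
  push_cast at h3
  rw [← h3, show (2 : ℤ) * k - (a + 1) - (a + 1 + m) + 1 = ((m + 1 + 2 * r : ℕ) : ℤ) by
    push_cast; omega, zpow_natCast, show k + 1 = a + 1 + m + 1 + r by omega] at h
  have hS : rescale (q ^ 3) (Δ q k (a + 1) (a + 1 + m)) =
      rescale q (rescale q (rescale q (Δ q k (a + 1) (a + 1 + m)))) := by
    simp only [rescale_rescale]; ring_nf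
  rw [hS] at h
  rw [map_pow] at h
  simp only [defect, map_sub, map_mul, map_pow, rescale_X, rescale_C]
  push_cast
  subst hk
  push_cast at *
  ring_nf at *
  linear_combination h

end Fermi

namespace Fermi
variable {K : Type*} [Field K]

theorem X_pow_dvd_rescale {f : PowerSeries K} {N : ℕ} (q : K) (h : X ^ N ∣ f) :
    X ^ N ∣ rescale q f := by
  rw [X_pow_dvd_iff] at h ⊢
  intro m hm
  rw [coeff_rescale, h m hm, mul_zero]

theorem eq_of_rec {q : K} (hq1 : ∀ n : ℕ, q ^ (n + 1) ≠ 1) {k : ℕ}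
    {G H : ℕ → ℕ → PowerSeries K}
    (hG : ∀ a b, a ≤ b → b ≤ k →
      G a b = ∑ i ∈ Finset.range (a + 1), X ^ i * rescale q (G (b - i) (k - i)))
    (hH : ∀ a b, a ≤ b → b ≤ k →
      H a b = ∑ i ∈ Finset.range (a + 1), X ^ i * rescale q (H (b - i) (k - i)))
    (h0 : coeff 0 (G k k) = coeff 0 (H k k)) {a b : ℕ} (hab : a ≤ b) (hbk : b ≤ k) :
    G a b = H a b := by
  ext n
  induction n using Nat.strong_induction_on generalizing a b with
  | _ n ih =>
    have step : ∀ a b, a ≤ b → b ≤ k →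
        coeff n (G a b) - coeff n (H a b) = q ^ n * (coeff n (G b k) - coeff n (H b k)) := by
      intro a b hab hbk
      rw [hG a b hab hbk, hH a b hab hbk, map_sum, map_sum, ← Finset.sum_sub_distrib,
        Finset.sum_range_succ', Finset.sum_eq_zero, zero_add]
      · simp [coeff_rescale, mul_sub]
      · intro i hi
        rw [Finset.mem_range] at hi
        simp only [coeff_X_pow_mul', coeff_rescale]
        split_ifs with h
        · rw [ih (n - (i + 1)) (by omega) (a := b - (i + 1)) (b := k - (i + 1)) (by omega)
            (by omega), sub_self]
        · exact sub_self 0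
    have top : coeff n (G k k) - coeff n (H k k) = 0 := by
      rcases n with _ | n
      · rw [h0, sub_self]
      · have := step k k le_rfl le_rfl
        have h1 : (1 - q ^ (n + 1)) * (coeff (n + 1) (G k k) - coeff (n + 1) (H k k)) = 0 := by
          linear_combination this
        exact (mul_eq_zero.1 h1).resolve_left (sub_ne_zero.2 (hq1 n).symm)
    rw [← sub_eq_zero, step a b hab hbk, step b k hbk le_rfl, top, mul_zero, mul_zero]

variable {q : K} (hq : q ≠ 0) (hq1 : ∀ n : ℕ, q ^ (n + 1) ≠ 1) {k : ℕ}
include hq hq1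

theorem X_pow_dvd_defect (N : ℕ) {a b : ℕ} (hab : a ≤ b) (hbk : b ≤ k) :
    X ^ N ∣ defect q k a b := by
  induction N generalizing a b with
  | zero => simp
  | succ N ih =>
    obtain ⟨d, rfl⟩ := Nat.exists_eq_add_of_le hab
    induction d generalizing a with
    | zero =>
      rw [add_zero] at hbk ⊢
      rw [defect_self hq hq1 hbk]
      exact dvd_zero _
    | succ m ihm =>
      rcases a with _ | a
      · rw [defect_zero hq]; exact dvd_zero _
      · have hX : ∀ {f g : PowerSeries K} (n : ℕ), X ^ N ∣ f → X ^ (N + 1) ∣ g * X ^ (n + 1) * f :=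
          fun n h => pow_succ' (X : PowerSeries K) N ▸
            mul_dvd_mul (Dvd.dvd.mul_left (pow_succ' (X : PowerSeries K) n ▸ dvd_mul_right _ _) _) h
        have hS := @X_pow_dvd_rescale K _
        obtain ⟨r, hr⟩ : ∃ r, a + 1 + m + r = k := ⟨k - (a + 1 + m), by omega⟩
        rw [← add_assoc, defect_rec hq hq1 (r := r) (by omega) hr]
        refine dvd_sub (dvd_sub (dvd_add (dvd_sub (dvd_add ?_ ?_) ?_) ?_) ?_) ?_
        · refine Dvd.dvd.mul_left ?_ _
          have := ihm (a := a + 2) (by omega) (by omega)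
          rwa [show a + 2 + m = a + 1 + m + 1 by omega] at this
        · simpa using hX (g := 1) 0 (ih (a := a) (b := a + 1 + m) (by omega) (by omega))
        · simpa using hX (g := C q) 0 (ih (a := a + 1) (b := a + 1 + m) (by omega) (by omega))
        · simpa using hX (g := 1) a (hS q (ih (a := m + 1) (b := m + r + 1) (by omega) (by omega)))
        · exact hX (a + 1) (hS q (ih (by omega) (by omega)))
        · exact hX _ (hS q (hS q (ih (by omega) (by omega))))

theorem defect_eq_zero {a b : ℕ} (hab : a ≤ b) (hbk : b ≤ k) : defect q k a b = 0 := by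
  ext n
  exact X_pow_dvd_iff.1 (X_pow_dvd_defect hq hq1 (n + 1) hab hbk) n (by omega)

theorem Δ_eq {a b : ℕ} (hab : a ≤ b) (hbk : b ≤ k) :
    Δ q k a b = X ^ a * rescale q
      (∑ i ∈ Finset.range (b - a + 1), Δ q k i ((k - a : ℕ) : ℤ)) := by
  induction b, hab using Nat.le_induction with
  | base =>
    have := defect_eq_zero hq hq1 le_rfl hbk
    rw [defect, Δ_self, sub_zero, sub_eq_zero] at this
    rw [this]
    simp [Nat.cast_sub hbk]
  | succ b hb ih =>
    have := defect_eq_zero hq hq1 (a := a) (b := b + 1) (by omega) hbk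
    rw [defect, Nat.cast_succ, add_sub_cancel_right, ih (by omega)] at this
    rw [Nat.sub_add_comm hb, Finset.sum_range_succ, map_add, Nat.cast_succ,
      show ((b - a + 1 : ℕ) : ℤ) = b + 1 - a by omega, show ((k - a : ℕ) : ℤ) = k - a by omega]
    rw [show ((k - a : ℕ) : ℤ) = k - a by omega] at this
    linear_combination this

theorem sum_Δ_rec (a b : ℕ) (hab : a ≤ b) (hbk : b ≤ k) :
    ∑ i ∈ Finset.range (a + 1), Δ q k i b = ∑ i ∈ Finset.range (a + 1), X ^ i * rescale q
      (∑ j ∈ Finset.range (b - i + 1), Δ q k j ((k - i : ℕ) : ℤ)) :=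
  Finset.sum_congr rfl fun i hi => Δ_eq hq hq1 (by rw [Finset.mem_range] at hi; omega) hbk

omit hq hq1 in
theorem sum_Δ_top (a : ℕ) : ∑ i ∈ Finset.range (a + 1), Δ q k i k = F q k (L a) := by
  induction a with
  | zero => simp [Δ_top, F_eq_zero (u := L (-1)) (by simp [L])]
  | succ a ih =>
    rw [Finset.sum_range_succ, ih, Δ_top]
    simp

omit hq hq1 in
theorem coeff_zero_F {u : ℤ → ℤ} (hu : u 0 = 0) : coeff 0 (F q k u) = 1 := by
  have : restricted k 0 = {0} := by
    ext m
    rw [mem_restricted, Finset.mem_singleton, Finset.sum_eq_zero_iff]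
    simp [funext_iff]
  rw [F, if_pos hu, fsum, coeff_mk, this, Finset.sum_singleton]
  simp [fterm, quadExp]

end Fermi

namespace Fermi

/-- Configurations with bounded triple sums and boundary conditions `f 0 ≤ a`, `f 0 + f 1 ≤ b`,
having `n` particles and energy `d`. -/
def conf (k a b n d : ℕ) : Set (ℕ →₀ ℕ) :=
  {f | (∀ i, f i + f (i + 1) + f (i + 2) ≤ k) ∧ f 0 ≤ a ∧ f 0 + f 1 ≤ b ∧
    (f.sum fun _ v => v) = n ∧ (f.sum fun i v => i * v) = d}

theorem conf_finite (k a b n d : ℕ) : (conf k a b n d).Finite := by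
  refine (Finset.finite_toSet (Finset.finsuppAntidiag (Finset.range (d + 1)) n)).subset ?_
  rintro f ⟨-, -, -, hn, hd⟩
  have hs : f.support ⊆ Finset.range (d + 1) := by
    intro i hi
    have h1 : i * f i ≤ d := hd ▸
      Finset.single_le_sum (f := fun i => i * f i) (fun _ _ => Nat.zero_le _) hi
    have h2 := Nat.pos_of_ne_zero (Finsupp.mem_support_iff.1 hi)
    rw [Finset.mem_range]
    nlinarith
  rw [Finset.mem_coe, Finset.mem_finsuppAntidiag]
  exact ⟨hn ▸ (Finsupp.sum_of_support_subset f hs (fun _ v => v) (fun _ _ => rfl)).symm, hs⟩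

/-- Prepend `i` to the finitely supported sequence `g`. -/
noncomputable def prepend (i : ℕ) (g : ℕ →₀ ℕ) : ℕ →₀ ℕ :=
  Finsupp.single 0 i + g.mapDomain Nat.succ

theorem prepend_zero (i : ℕ) (g : ℕ →₀ ℕ) : prepend i g 0 = i := by
  simp [prepend, Finsupp.mapDomain_of_notMem_range]

theorem prepend_succ (i : ℕ) (g : ℕ →₀ ℕ) (j : ℕ) : prepend i g (j + 1) = g j := by
  simp [prepend, Finsupp.mapDomain_apply Nat.succ_injective g j]

theorem prepend_injective (i : ℕ) : Function.Injective (prepend i) := by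
  intro f g h
  ext j
  rw [← prepend_succ i f, h, prepend_succ]

theorem exists_prepend (f : ℕ →₀ ℕ) : ∃ g, prepend (f 0) g = f := by
  refine ⟨f.comapDomain Nat.succ Nat.succ_injective.injOn, ?_⟩
  ext (_ | j)
  · exact prepend_zero _ _
  · rw [prepend_succ, Finsupp.comapDomain_apply]

theorem sum_prepend (i : ℕ) (g : ℕ →₀ ℕ) :
    ((prepend i g).sum fun _ v => v) = i + g.sum fun _ v => v := by
  rw [prepend, Finsupp.sum_add_index' (fun _ => rfl) (fun _ _ _ => rfl),
    Finsupp.sum_single_index rfl, Finsupp.sum_mapDomain_index (fun _ => rfl) (fun _ _ _ => rfl)]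

theorem sum_mul_prepend (i : ℕ) (g : ℕ →₀ ℕ) :
    ((prepend i g).sum fun j v => j * v) = (g.sum fun j v => j * v) + g.sum fun _ v => v := by
  rw [prepend, Finsupp.sum_add_index' (by simp) (fun _ _ _ => mul_add _ _ _),
    Finsupp.sum_single_index (by simp),
    Finsupp.sum_mapDomain_index (by simp) (fun _ _ _ => mul_add _ _ _), zero_mul, zero_add,
    ← Finsupp.sum_add]
  simp [Nat.succ_mul]

theorem mem_conf_prepend {k a b n d i : ℕ} (hab : a ≤ b) (hbk : b ≤ k) (hi : i ≤ a)
    {g : ℕ →₀ ℕ} : prepend i g ∈ conf k a b n d ↔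
      i ≤ n ∧ n - i ≤ d ∧ g ∈ conf k (b - i) (k - i) (n - i) (d - (n - i)) := by
  simp only [conf, Set.mem_ofPred_eq, sum_prepend, sum_mul_prepend, prepend_zero,
    show prepend i g 1 = g 0 from prepend_succ i g 0]
  constructor
  · rintro ⟨h, h1, h2, h3, h4⟩
    have h0 := h 0
    rw [prepend_zero, zero_add, zero_add, prepend_succ,
      show prepend i g 2 = g 1 from prepend_succ i g 1] at h0
    refine ⟨by omega, by omega, fun j => ?_, by omega, by omega, by omega, by omega⟩
    have := h (j + 1)
    rwa [prepend_succ, show j + 1 + 2 = j + 2 + 1 by ring, prepend_succ, prepend_succ] at this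
  · rintro ⟨h1, h2, h, h3, h4, h5, h6⟩
    refine ⟨fun j => ?_, hi, by omega, by omega, by omega⟩
    rcases j with _ | j
    · rw [prepend_zero, zero_add, zero_add, prepend_succ,
        show prepend i g 2 = g 1 from prepend_succ i g 1]
      omega
    · rw [prepend_succ, show j + 1 + 2 = j + 2 + 1 by ring, prepend_succ, prepend_succ]
      exact h j

theorem ncard_conf {k a b : ℕ} (n d : ℕ) (hab : a ≤ b) (hbk : b ≤ k) :
    (conf k a b n d).ncard = ∑ i ∈ Finset.range (a + 1),
      if i ≤ n ∧ n - i ≤ d then (conf k (b - i) (k - i) (n - i) (d - (n - i))).ncard else 0 := by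
  classical
  rw [Set.ncard_eq_toFinset_card _ (conf_finite k a b n d),
    Finset.card_eq_sum_card_fiberwise (f := fun f => f 0) (t := Finset.range (a + 1))]
  · refine Finset.sum_congr rfl fun i hi => ?_
    rw [Finset.mem_range, Nat.lt_succ_iff] at hi
    rw [← Set.ncard_coe_finset]
    have key : ∀ f : ℕ →₀ ℕ, (f ∈ conf k a b n d ∧ f 0 = i) ↔ ((i ≤ n ∧ n - i ≤ d) ∧
        f ∈ prepend i '' conf k (b - i) (k - i) (n - i) (d - (n - i))) := by
      intro f
      constructor
      · rintro ⟨hf, rfl⟩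
        obtain ⟨g, hg⟩ := exists_prepend f
        have := hf
        rw [← hg, mem_conf_prepend hab hbk hi] at this
        exact ⟨⟨this.1, this.2.1⟩, g, this.2.2, hg⟩
      · rintro ⟨h, g, hg, rfl⟩
        exact ⟨(mem_conf_prepend hab hbk hi).2 ⟨h.1, h.2, hg⟩, prepend_zero i g⟩
    split_ifs with h
    · rw [← Set.ncard_image_of_injective (conf k (b - i) (k - i) (n - i) (d - (n - i)))
        (prepend_injective i)]
      congr 1
      ext f
      simpa only [Finset.coe_filter, Set.Finite.mem_toFinset, Set.mem_ofPred_eq, h, and_self,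
        true_and] using key f
    · rw [Set.ncard_eq_zero, Set.eq_empty_iff_forall_notMem]
      intro f hf
      rw [Finset.mem_coe, Finset.mem_filter, Set.Finite.mem_toFinset] at hf
      exact h ((key f).1 hf).1
  · intro f hf
    have := (conf_finite k a b n d).mem_toFinset.1 hf
    simpa [Nat.lt_succ_iff] using this.2.1

/-- The generating function of configurations with `n` particles. -/
noncomputable def character (k a b n : ℕ) : PowerSeries ℂ :=
  PowerSeries.mk fun d => ((conf k a b n d).ncard : ℂ)

theorem character_rec {k a b : ℕ} (n : ℕ) (hab : a ≤ b) (hbk : b ≤ k) :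
    character k a b n = ∑ i ∈ Finset.range (a + 1),
      if i ≤ n then X ^ (n - i) * character k (b - i) (k - i) (n - i) else 0 := by
  ext d
  rw [character, coeff_mk, ncard_conf n d hab hbk, map_sum, Nat.cast_sum]
  refine Finset.sum_congr rfl fun i _ => ?_
  by_cases h : i ≤ n <;> by_cases h' : n - i ≤ d <;> simp [h, h', coeff_X_pow_mul', character]

theorem character_zero (k a b : ℕ) : character k a b 0 = 1 := by
  ext d
  rw [character, coeff_mk, coeff_one]
  have : ∀ f : ℕ →₀ ℕ, f ∈ conf k a b 0 d ↔ f = 0 ∧ d = 0 := by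
    intro f
    constructor
    · rintro ⟨-, -, -, h, h'⟩
      have : f = 0 := by
        ext i
        by_contra hi
        exact hi (Finset.sum_eq_zero_iff.1 h i (Finsupp.mem_support_iff.2 hi))
      subst this
      exact ⟨rfl, by simpa using h'.symm⟩
    · rintro ⟨rfl, rfl⟩
      simp [conf]
  split_ifs with hd
  · rw [show conf k a b 0 d = {0} by ext f; rw [this f]; simp [hd]]
    simp
  · rw [show conf k a b 0 d = ∅ by ext f; rw [this f]; simp [hd]]
    simp

variable {K : Type*} [Field K]

theorem F_eq_character (ι : PowerSeries ℂ →+* K) (hι : Function.Injective ι) (k a : ℕ)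
    (ha : a ≤ k) : F (ι X) k (L a) = PowerSeries.mk fun n => ι (character k a k n) := by
  have hq : ι X ≠ 0 := (map_ne_zero_iff ι hι).2 X_ne_zero
  have hq1 : ∀ n : ℕ, ι X ^ (n + 1) ≠ 1 := by
    intro n h
    rw [← map_pow, ← map_one ι] at h
    have := congrArg constantCoeff (hι h)
    simp at this
  rw [← sum_Δ_top]
  refine eq_of_rec hq1 (k := k) (G := fun a b => ∑ i ∈ Finset.range (a + 1), Δ (ι X) k i b)
    (H := fun a b => PowerSeries.mk fun n => ι (character k a b n)) (sum_Δ_rec hq hq1) ?_ ?_ ha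
    le_rfl
  · intro a b hab hbk
    ext n
    simp only [coeff_mk, character_rec n hab hbk, map_sum, coeff_X_pow_mul', coeff_rescale]
    refine Finset.sum_congr rfl fun i _ => ?_
    split_ifs <;> simp
  · simp only [sum_Δ_top, coeff_mk, character_zero, map_one]
    exact coeff_zero_F (by simp [L])

theorem fterm_map (ι : PowerSeries ℂ →+* K) (k : ℕ)
    (m : Fin k → ℕ) : fterm (ι X) k (L ((k + 1) / 2 : ℕ)) m = ι (X ^ (fermiExp3 k m) *
      (∏ a : Fin k, ∏ j ∈ Finset.range (m a), (1 - (X : PowerSeries ℂ) ^ (j + 1)))⁻¹) := by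
  have h0 : constantCoeff (∏ a : Fin k, ∏ j ∈ Finset.range (m a),
      (1 - (X : PowerSeries ℂ) ^ (j + 1))) ≠ 0 := by
    simp [map_prod]
  have h1 := congrArg ι (PowerSeries.mul_inv_cancel _ h0)
  rw [map_mul, map_one] at h1
  have h2 : ∑ a : Fin k, L ((k + 1) / 2 : ℕ) ((a : ℕ) + 1) * (m a : ℤ) =
      ((∑ a : Fin k, (((a : ℕ) + 1) - (k + 1) / 2) * m a : ℕ) : ℤ) := by
    rw [Nat.cast_sum]
    refine Finset.sum_congr rfl fun a _ => ?_
    rw [Nat.cast_mul]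
    congr 1
    simp only [L]
    omega
  rw [map_mul, eq_inv_of_mul_eq_one_right h1, fterm, h2, zpow_natCast, ← pow_add, map_pow]
  simp only [map_prod, map_sub, map_one, map_pow]
  rfl

end Fermi

/-- The character of `(k,3)`-admissible configurations (sequences with
`a_i + a_{i+1} + a_{i+2} ≤ k`) with `a_0 ≤ ⌊(k+1)/2⌋` (and `a_0 + a_1 ≤ k`) equals
`Σ_n z^n Σ_{m_1+2m_2+⋯+km_k=n} q^{½(mᵀBm − diagB·m)+c·m}/((q)_{m_1}⋯(q)_{m_k})` with
`B_{ab} = 2min(a,b) + (a+b−k)₊` and `c_a = (a − ⌊(k+1)/2⌋)₊`; stated as a power-series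
identity in `q` for each coefficient of `z^n`. -/
theorem fermionic_formula_k3_special (k : ℕ) (hk : 1 ≤ k) (n : ℕ) :
    (PowerSeries.mk fun d : ℕ =>
      (Set.ncard {a : ℕ →₀ ℕ |
          (∀ i, a i + a (i + 1) + a (i + 2) ≤ k) ∧ a 0 ≤ (k + 1) / 2 ∧ a 0 + a 1 ≤ k ∧
          (a.sum fun _ v => v) = n ∧ (a.sum fun i v => i * v) = d} : ℂ)) =
    ∑ m ∈ restricted k n,
      (PowerSeries.X : PowerSeries ℂ) ^ (fermiExp3 k m) *
        (∏ a : Fin k, ∏ j ∈ Finset.range (m a),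
          (1 - (PowerSeries.X : PowerSeries ℂ) ^ (j + 1)))⁻¹ := by
  have hι := IsFractionRing.injective (PowerSeries ℂ) (FractionRing (PowerSeries ℂ))
  have h := congrArg (coeff n) (Fermi.F_eq_character (algebraMap _ _) hι k ((k + 1) / 2) (by omega))
  rw [Fermi.F, if_pos (by simp only [Fermi.L]; omega), Fermi.fsum, coeff_mk, coeff_mk] at h
  simp only [Fermi.fterm_map] at h
  rw [← map_sum] at h
  exact (hι h).symm
end
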